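/- Let M be a compact topological n-manifold and let r be a natural number. Then there exists a constant C (depending on M and r alone) such that for every prime p and every elementary abelian p-group E of rank r acting continuously and effectively on M with the property that the stabilizer of every point of M is either trivial or of order p, the set Stab(E,M) of stabilizer subgroups is finite with |Stab(E,M)| ≤ C. -/

import Mathlib

namespace AlexanderSpanier

/-! ### Relative generation of subspaces -/

section Generation

variable {k F F' : Type*} [Field k] [AddCommGroup F] [Module k F] [AddCommGroup F'] [Module k F']

/-- `A` is contained in the sum of `B` and a subspace spanned by at most `m` vectors; equivalently,
the image of `A` in the quotient by `B` has dimension at most `m`. -/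
def GenMod (A B : Submodule k F) (m : ℕ) : Prop :=
  ∃ s : Finset F, s.card ≤ m ∧ A ≤ B ⊔ Submodule.span k (s : Set F)

variable {A A' B B' C : Submodule k F} {m m' : ℕ}

theorem GenMod.of_le (h : A ≤ B) : GenMod A B m :=
  ⟨∅, by simp, h.trans le_sup_left⟩

theorem genMod_zero_iff : GenMod A B 0 ↔ A ≤ B := by
  refine ⟨?_, GenMod.of_le⟩
  rintro ⟨s, hs, h⟩
  obtain rfl : s = ∅ := by simpa using hs
  simpa using h

theorem GenMod.mono (h : GenMod A B m) (hA : A' ≤ A) (hB : B ≤ B') (hm : m ≤ m') :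
    GenMod A' B' m' := by
  obtain ⟨s, hs, h⟩ := h
  exact ⟨s, hs.trans hm, hA.trans (h.trans (sup_le_sup_right hB _))⟩

theorem GenMod.trans (h : GenMod A B m) (h' : GenMod B C m') : GenMod A C (m + m') := by
  classical
  obtain ⟨s, hs, h⟩ := h
  obtain ⟨t, ht, h'⟩ := h'
  refine ⟨s ∪ t, (Finset.card_union_le _ _).trans (by omega), h.trans (sup_le (h'.trans ?_) ?_)⟩
  · exact sup_le_sup_left (Submodule.span_mono (by simp)) _
  · exact le_sup_of_le_right (Submodule.span_mono (by simp))

theorem GenMod.map (h : GenMod A B m) (φ : F →ₗ[k] F') : GenMod (A.map φ) (B.map φ) m := by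
  classical
  obtain ⟨s, hs, h⟩ := h
  refine ⟨s.image φ, Finset.card_image_le.trans hs, ?_⟩
  rw [Finset.coe_image, ← Submodule.map_span, ← Submodule.map_sup]
  exact Submodule.map_mono h

/-- Codimension bounds pull back along linear maps. -/
theorem GenMod.comap {A : Submodule k F} {B : Submodule k F'} (φ : F →ₗ[k] F')
    (h : GenMod (A.map φ) B m) : GenMod A (A ⊓ B.comap φ) m := by
  classical
  obtain ⟨s, hs, h⟩ := h
  set ψ : A →ₗ[k] F' ⧸ B := (B.mkQ ∘ₗ φ).domRestrict A with hψ
  have hr : LinearMap.range ψ ≤ Submodule.span k ((s.image B.mkQ : Finset _) : Set (F' ⧸ B)) := by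
    rintro _ ⟨a, rfl⟩
    have h1 : φ a ∈ B ⊔ Submodule.span k (s : Set F') := h ⟨a, a.2, rfl⟩
    obtain ⟨b, hb, c, hc, hbc⟩ := Submodule.mem_sup.1 h1
    have : ψ a = B.mkQ c := by
      simp [hψ, ← hbc, (Submodule.Quotient.mk_eq_zero B).2 hb]
    rw [this, Finset.coe_image, ← Submodule.map_span]
    exact ⟨c, hc, rfl⟩
  have hfin : FiniteDimensional k (LinearMap.range ψ) :=
    Submodule.finiteDimensional_of_le hr
  have hcard : Module.finrank k (LinearMap.range ψ) ≤ m :=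
    (Submodule.finrank_mono hr).trans
      ((finrank_span_finset_le_card _).trans (Finset.card_image_le.trans hs))
  let b := Module.finBasis k (LinearMap.range ψ)
  choose v hv using fun i => (b i).2
  refine ⟨Finset.univ.image fun i => (v i : F), Finset.card_image_le.trans (by simpa using hcard),
    fun a ha => ?_⟩
  set c := b.repr ⟨ψ ⟨a, ha⟩, ⟨_, rfl⟩⟩
  have hsum : ψ ⟨a, ha⟩ = ψ (∑ i, c i • v i) := by
    have := congrArg Subtype.val (b.sum_repr ⟨ψ ⟨a, ha⟩, ⟨_, rfl⟩⟩)
    rw [map_sum]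
    simp only [map_smul, hv]
    refine this.symm.trans ?_
    simp only [c, Submodule.coe_sum, Submodule.coe_smul]
  have hz : a - ((∑ i, c i • v i : A) : F) ∈ A ⊓ B.comap φ := by
    refine ⟨A.sub_mem ha (Subtype.property _), ?_⟩
    have h0 : ψ (⟨a, ha⟩ - ∑ i, c i • v i) = 0 := by rw [map_sub, hsum, sub_self]
    have := (Submodule.Quotient.mk_eq_zero B).1 h0
    simpa using this
  rw [← sub_add_cancel a ((∑ i, c i • v i : A) : F)]
  refine Submodule.add_mem_sup hz ?_
  rw [Submodule.coe_sum]
  exact Submodule.sum_mem _ fun i _ => Submodule.smul_mem _ _ (Submodule.subset_span (by simp))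

theorem GenMod.inf_left (h : GenMod A B m) : GenMod A (A ⊓ B) m :=
  GenMod.comap LinearMap.id (by simpa using h)

theorem GenMod.inf {B₁ B₂ : Submodule k F} (h₁ : GenMod A B₁ m) (h₂ : GenMod A B₂ m') :
    GenMod A (A ⊓ B₁ ⊓ B₂) (m + m') :=
  h₁.inf_left.trans (h₂.mono inf_le_left le_rfl le_rfl).inf_left

end Generation

/-! ### Cochains on finite sequences of points -/

section Cochains

variable {X Y k : Type*} [Field k]

/-- The value on a list of the alternating coboundary of a cochain. -/
def cobdAux : List X → (List X → k) → k
  | [], _ => 0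
  | x :: l, f => f l - cobdAux l fun l' => f (x :: l')

/-- The value on a list of the prism operator of two maps. -/
def prismAux (u v : X → Y) : List X → (List Y → k) → k
  | [], _ => 0
  | x :: l, f => f (u x :: v x :: l.map v) - prismAux u v l fun l' => f (u x :: l')

theorem cobdAux_add (l : List X) (f g : List X → k) :
    cobdAux l (f + g) = cobdAux l f + cobdAux l g := by
  induction l generalizing f g with
  | nil => simp [cobdAux]
  | cons x l ih =>
    have := ih (fun l' => f (x :: l')) fun l' => g (x :: l')
    simp only [cobdAux, Pi.add_apply]
    simp only [Pi.add_def] at this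
    rw [this]; ring

theorem cobdAux_smul (l : List X) (c : k) (f : List X → k) :
    cobdAux l (c • f) = c * cobdAux l f := by
  induction l generalizing f with
  | nil => simp [cobdAux]
  | cons x l ih =>
    have := ih fun l' => f (x :: l')
    simp only [cobdAux, Pi.smul_apply, smul_eq_mul]
    simp only [Pi.smul_def, smul_eq_mul] at this
    rw [this]; ring

theorem prismAux_add (u v : X → Y) (l : List X) (f g : List Y → k) :
    prismAux u v l (f + g) = prismAux u v l f + prismAux u v l g := by
  induction l generalizing f g with
  | nil => simp [prismAux]
  | cons x l ih =>
    have := ih (fun l' => f (u x :: l')) fun l' => g (u x :: l')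
    simp only [prismAux, Pi.add_apply]
    simp only [Pi.add_def] at this
    rw [this]; ring

theorem prismAux_smul (u v : X → Y) (l : List X) (c : k) (f : List Y → k) :
    prismAux u v l (c • f) = c * prismAux u v l f := by
  induction l generalizing f with
  | nil => simp [prismAux]
  | cons x l ih =>
    have := ih fun l' => f (u x :: l')
    simp only [prismAux, Pi.smul_apply, smul_eq_mul]
    simp only [Pi.smul_def, smul_eq_mul] at this
    rw [this]; ring

/-- The alternating coboundary. The empty list is included, so this is the augmented complex. -/
def cobd : (List X → k) →ₗ[k] (List X → k) where
  toFun f l := cobdAux l f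
  map_add' f g := funext fun l => cobdAux_add l f g
  map_smul' c f := funext fun l => cobdAux_smul l c f

/-- The prism operator, a homotopy between the pullbacks along two maps. -/
def prism (u v : X → Y) : (List Y → k) →ₗ[k] (List X → k) where
  toFun f l := prismAux u v l f
  map_add' f g := funext fun l => prismAux_add u v l f g
  map_smul' c f := funext fun l => prismAux_smul u v l c f

/-- Pullback of cochains along a map of sets. -/
def pull (u : X → Y) : (List Y → k) →ₗ[k] (List X → k) :=
  LinearMap.funLeft k k (List.map u)

/-- Multiplication of cochains by a function. -/
def mulFn (w : List X → k) : (List X → k) →ₗ[k] (List X → k) where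
  toFun f := w * f
  map_add' := mul_add w
  map_smul' c f := mul_smul_comm c w f

@[simp] theorem pull_apply (u : X → Y) (f : List Y → k) (l : List X) :
    pull u f l = f (l.map u) := rfl

@[simp] theorem mulFn_apply (w f : List X → k) (l : List X) : mulFn w f l = w l * f l := rfl

@[simp] theorem cobd_nil (f : List X → k) : cobd f [] = 0 := rfl

theorem cobd_cons (f : List X → k) (x : X) (l : List X) :
    cobd f (x :: l) = f l - cobd (fun l' => f (x :: l')) l := rfl

@[simp] theorem prism_nil (u v : X → Y) (f : List Y → k) : prism u v f [] = 0 := rfl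

theorem prism_cons (u v : X → Y) (f : List Y → k) (x : X) (l : List X) :
    prism u v f (x :: l) =
      f (u x :: v x :: l.map v) - prism u v (fun l' => f (u x :: l')) l := rfl

theorem cobd_cobd (f : List X → k) : cobd (cobd f) = 0 := by
  funext l
  induction l generalizing f with
  | nil => rfl
  | cons x l ih =>
    have h : (fun l' => cobd f (x :: l')) = f - cobd fun l' => f (x :: l') := by
      funext l'; rw [cobd_cons]; rfl
    have := ih fun l' => f (x :: l')
    rw [cobd_cons, h, map_sub, Pi.sub_apply, this]
    simp

theorem cobd_pull (u : X → Y) (f : List Y → k) : cobd (pull u f) = pull u (cobd f) := by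
  funext l
  induction l generalizing f with
  | nil => rfl
  | cons x l ih =>
    have := ih fun l' => f (u x :: l')
    rw [pull_apply] at this
    rw [cobd_cons, pull_apply, pull_apply, List.map_cons, cobd_cons, ← this]
    rfl

/-- The prism operator is a chain homotopy. -/
theorem cobd_prism (u v : X → Y) (f : List Y → k) :
    cobd (prism u v f) + prism u v (cobd f) = pull v f - pull u f := by
  funext l
  induction l generalizing f with
  | nil => simp
  | cons x l ih =>
    have h1 : (fun l' => prism u v f (x :: l')) =
        pull v (fun l' => f (u x :: v x :: l')) - prism u v fun l' => f (u x :: l') := by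
      funext l'; rw [prism_cons]; rfl
    have h2 : (fun l' => cobd f (u x :: l')) = f - cobd fun l' => f (u x :: l') := by
      funext l'; rw [cobd_cons]; rfl
    have := ih fun l' => f (u x :: l')
    simp only [Pi.add_apply, Pi.sub_apply, pull_apply] at this
    simp only [Pi.add_apply, Pi.sub_apply, pull_apply, List.map_cons]
    rw [cobd_cons, prism_cons, h1, h2, map_sub, map_sub, cobd_pull, cobd_cons, cobd_cons]
    simp only [Pi.sub_apply, pull_apply]
    linear_combination this

theorem cobd_eq_zero {f : List X → k} {l : List X}
    (h : ∀ l', l'.length + 1 = l.length → l' ⊆ l → f l' = 0) : cobd f l = 0 := by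
  induction l generalizing f with
  | nil => rfl
  | cons x l ih =>
    rw [cobd_cons, h l rfl (List.subset_cons_self x l), ih, sub_zero]
    intro l' hl' hs
    exact h _ (by simp [hl']) (List.cons_subset_cons x hs)

theorem prism_eq_zero {u v : X → Y} {f : List Y → k} {l : List X}
    (h : ∀ l', l'.length = l.length + 1 → l' ⊆ l.map u ++ l.map v → f l' = 0) :
    prism u v f l = 0 := by
  induction l generalizing f with
  | nil => rfl
  | cons x l ih =>
    rw [prism_cons, h _ (by simp), ih, sub_zero]
    · intro l' hl' hs
      refine h _ (by simp [hl']) ?_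
      intro y hy
      have := @hs y
      simp only [List.mem_cons, List.mem_append, List.map_cons] at *
      tauto
    · intro y hy
      simp only [List.mem_cons, List.mem_append, List.map_cons] at *
      tauto

theorem pull_pull {W : Type*} (u : X → Y) (v : Y → W) (f : List W → k) :
    pull u (pull v f) = pull (v ∘ u) f := by
  funext l; simp

theorem prism_pull {u v : X → X} {w : X → X} (hu : ∀ x, u (w x) = w (u x))
    (hv : ∀ x, v (w x) = w (v x)) (f : List X → k) :
    prism u v (pull w f) = pull w (prism u v f) := by
  funext l
  induction l generalizing f with
  | nil => rfl
  | cons x l ih =>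
    have := ih fun l' => f (w (u x) :: l')
    rw [pull_apply] at this
    have h2 : (v ∘ w) = w ∘ v := funext hv
    rw [pull_apply, List.map_cons, prism_cons, prism_cons, hu, hv, ← this, pull_apply]
    simp [h2]
    rfl

theorem cobd_const (a : k) (l : List X) :
    cobd (fun _ => a) l = if Odd l.length then a else 0 := by
  induction l with
  | nil => simp
  | cons x l ih =>
    rw [cobd_cons, ih, List.length_cons]
    by_cases h : Odd l.length <;> simp [h, Nat.odd_add_one]

end Cochains

/-! ### Alexander–Spanier cohomology of open subsets -/

section Local

variable {X : Type*} [TopologicalSpace X]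

/-- Cochains which vanish on the lists of length `n` contained in a sufficiently small
neighbourhood of some point of `U`, and on the empty list if `n = 0`. -/
def locZero (k : Type*) [Field k] (U : Set X) (n : ℕ) : Submodule k (List X → k) where
  carrier := {f | (n = 0 → f [] = 0) ∧
    ∀ x ∈ U, ∃ N ∈ nhds x, ∀ l : List X, l.length = n → (∀ y ∈ l, y ∈ N) → f l = 0}
  zero_mem' := ⟨fun _ => rfl, fun _ _ => ⟨Set.univ, Filter.univ_mem, fun _ _ _ => rfl⟩⟩
  add_mem' := by
    rintro f g ⟨hf0, hf⟩ ⟨hg0, hg⟩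
    refine ⟨fun h => by simp [hf0 h, hg0 h], fun x hx => ?_⟩
    obtain ⟨N, hN, hf⟩ := hf x hx
    obtain ⟨N', hN', hg⟩ := hg x hx
    refine ⟨N ∩ N', Filter.inter_mem hN hN', fun l hl h => ?_⟩
    simp [hf l hl fun y hy => (h y hy).1, hg l hl fun y hy => (h y hy).2]
  smul_mem' := by
    rintro c f ⟨hf0, hf⟩
    refine ⟨fun h => by simp [hf0 h], fun x hx => ?_⟩
    obtain ⟨N, hN, hf⟩ := hf x hx
    exact ⟨N, hN, fun l hl h => by simp [hf l hl h]⟩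

/-- Cochains which are cocycles in degree `n` near the diagonal of `U`. -/
def cyc (k : Type*) [Field k] (U : Set X) (n : ℕ) : Submodule k (List X → k) :=
  (locZero k U (n + 1)).comap cobd

/-- Cochains which are coboundaries in degree `n` near the diagonal of `U`. -/
def bdry (k : Type*) [Field k] (U : Set X) (n : ℕ) : Submodule k (List X → k) :=
  LinearMap.range cobd ⊔ locZero k U n

variable {k : Type*} [Field k] {U V : Set X} {n : ℕ} {f g : List X → k}

theorem mem_locZero : f ∈ locZero k U n ↔ (n = 0 → f [] = 0) ∧
    ∀ x ∈ U, ∃ N ∈ nhds x, ∀ l : List X, l.length = n → (∀ y ∈ l, y ∈ N) → f l = 0 := Iff.rfl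

theorem locZero_anti (h : U ⊆ V) : locZero k V n ≤ locZero k U n :=
  fun _ hf => ⟨hf.1, fun x hx => hf.2 x (h hx)⟩

theorem mem_locZero_union (hU : f ∈ locZero k U n) (hV : f ∈ locZero k V n) :
    f ∈ locZero k (U ∪ V) n :=
  ⟨hU.1, fun x hx => hx.elim (hU.2 x) (hV.2 x)⟩

theorem cobd_mem_locZero (hf : f ∈ locZero k U n) : cobd f ∈ locZero k U (n + 1) := by
  refine ⟨by simp, fun x hx => ?_⟩
  obtain ⟨N, hN, hf⟩ := hf.2 x hx
  exact ⟨N, hN, fun l hl h => cobd_eq_zero fun l' hl' hs =>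
    hf l' (by omega) fun y hy => h y (hs hy)⟩

theorem mem_cyc : f ∈ cyc k U n ↔ cobd f ∈ locZero k U (n + 1) := Iff.rfl

theorem locZero_le_cyc : locZero k U n ≤ cyc k U n := fun _ hf => cobd_mem_locZero hf

theorem cobd_mem_cyc (f : List X → k) : cobd f ∈ cyc k U n := by
  rw [mem_cyc, cobd_cobd]; exact Submodule.zero_mem _

theorem cyc_anti (h : U ⊆ V) : cyc k V n ≤ cyc k U n := Submodule.comap_mono (locZero_anti h)

theorem bdry_anti (h : U ⊆ V) : bdry k V n ≤ bdry k U n := sup_le_sup_left (locZero_anti h) _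

theorem genMod_bdry_zero (A : Submodule k (List X → k)) : GenMod A (bdry k U 0) 1 := by
  refine ⟨{fun _ => 1}, by simp, fun f _ => ?_⟩
  rw [← sub_add_cancel f (f [] • fun _ => 1)]
  refine Submodule.add_mem_sup (Submodule.mem_sup_right ?_)
    (Submodule.smul_mem _ _ (Submodule.subset_span (by simp)))
  refine ⟨by simp, fun x _ => ⟨Set.univ, Filter.univ_mem, fun l hl _ => ?_⟩⟩
  obtain rfl := List.length_eq_zero_iff.1 hl
  simp

open Classical in
/-- The indicator function of the lists whose first entry lies in `S`. -/
noncomputable def headInd (k : Type*) [Field k] (S : Set X) (l : List X) : k :=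
  if ∃ x, l.head? = some x ∧ x ∈ S then 1 else 0

theorem exists_partition [CompletelyNormalSpace X] (hU : IsOpen U) (hV : IsOpen V) :
    ∃ S : Set X, ∀ (n : ℕ) (f : List X → k), f ∈ locZero k (U ∩ V) n →
      f - mulFn (headInd k S) f ∈ locZero k U n ∧ mulFn (headInd k S) f ∈ locZero k V n := by
  have h1 : Disjoint (closure (U \ V)) (V \ U) :=
    (Set.disjoint_left.2 fun x hx hx' => hx.2 hx').closure_left hV |>.mono_right Set.sdiff_subset
  have h2 : Disjoint (U \ V) (closure (V \ U)) :=
    ((Set.disjoint_left.2 fun x hx hx' => hx'.2 hx).closure_right hU).mono_left Set.sdiff_subset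
  obtain ⟨S, S', hS, hS', hUS, hVS, hd⟩ :=
    separatedNhds_iff_disjoint.2 (CompletelyNormalSpace.completely_normal h1 h2)
  refine ⟨S, fun n f hf => ⟨⟨fun h => ?_, fun x hx => ?_⟩, ⟨fun h => ?_, fun x hx => ?_⟩⟩⟩
  · simp [hf.1 h]
  · by_cases hxV : x ∈ V
    · obtain ⟨N, hN, h⟩ := hf.2 x ⟨hx, hxV⟩
      exact ⟨N, hN, fun l hl hlN => by simp [h l hl hlN]⟩
    · refine ⟨S, hS.mem_nhds (hUS ⟨hx, hxV⟩), fun l hl h => ?_⟩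
      cases l with
      | nil => simp [hf.1 hl.symm]
      | cons y l => simp [headInd, h y (by simp)]
  · simp [hf.1 h]
  · by_cases hxU : x ∈ U
    · obtain ⟨N, hN, h⟩ := hf.2 x ⟨hxU, hx⟩
      exact ⟨N, hN, fun l hl hlN => by simp [h l hl hlN]⟩
    · refine ⟨S', hS'.mem_nhds (hVS ⟨hx, hxU⟩), fun l hl h => ?_⟩
      cases l with
      | nil => simp [headInd]
      | cons y l => simp [headInd, Set.disjoint_right.1 hd (h y (by simp))]

/-- A Mayer–Vietoris estimate for the ranks of restriction maps. -/
theorem genMod_mayerVietoris [CompletelyNormalSpace X] {V₁ V₂ W₁ W₂ : Set X} {a b c : ℕ}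
    (hV₁ : IsOpen V₁) (hV₂ : IsOpen V₂) (hW₁ : IsOpen W₁) (hW₂ : IsOpen W₂)
    (hWV₁ : W₁ ⊆ V₁) (hWV₂ : W₂ ⊆ V₂)
    (h₁ : GenMod (cyc k U (n + 1)) (bdry k V₁ (n + 1)) a)
    (h₂ : GenMod (cyc k U (n + 1)) (bdry k V₂ (n + 1)) b)
    (h : GenMod (cyc k (V₁ ∩ V₂) n) (bdry k (W₁ ∩ W₂) n) c) :
    GenMod (cyc k U (n + 1)) (bdry k (W₁ ∪ W₂) (n + 1)) (a + b + c) := by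
  obtain ⟨S, hS⟩ := exists_partition (k := k) hV₁ hV₂
  obtain ⟨S', hS'⟩ := exists_partition (k := k) hW₁ hW₂
  refine (h₁.inf h₂).trans ?_
  set conn : (List X → k) →ₗ[k] (List X → k) := mulFn (headInd k S) ∘ₗ cobd with h_def
  have key : cyc k U (n + 1) ⊓ bdry k V₁ (n + 1) ⊓ bdry k V₂ (n + 1) ≤
      (cyc k (V₁ ∩ V₂) n).map conn ⊔ bdry k (W₁ ∪ W₂) (n + 1) := by
    rintro f ⟨⟨-, hf1⟩, hf2⟩
    obtain ⟨_, ⟨g₁, rfl⟩, z₁, hz₁, e₁⟩ := Submodule.mem_sup.1 hf1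
    obtain ⟨_, ⟨g₂, rfl⟩, z₂, hz₂, e₂⟩ := Submodule.mem_sup.1 hf2
    have hu : cobd (g₁ - g₂) = z₂ - z₁ := by
      rw [map_sub]; linear_combination e₁ - e₂
    have hmem : g₁ - g₂ ∈ cyc k (V₁ ∩ V₂) n := by
      rw [mem_cyc, hu]
      exact Submodule.sub_mem _ (locZero_anti Set.inter_subset_right hz₂)
        (locZero_anti Set.inter_subset_left hz₁)
    obtain ⟨p1, p2⟩ := hS _ _ (mem_cyc.1 hmem)
    have : f = conn (g₁ - g₂) + (cobd g₂ + (z₂ - conn (g₁ - g₂))) := by rw [← e₂]; ring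
    rw [this]
    refine Submodule.add_mem_sup ⟨_, hmem, rfl⟩ (Submodule.add_mem_sup ⟨_, rfl⟩ ?_)
    refine locZero_anti (Set.union_subset_union hWV₁ hWV₂) (mem_locZero_union ?_ ?_)
    · have : z₂ - conn (g₁ - g₂) = (cobd (g₁ - g₂) - conn (g₁ - g₂)) + z₁ := by rw [hu]; ring
      rw [this]
      exact Submodule.add_mem _ p1 hz₁
    · exact Submodule.sub_mem _ hz₂ p2
  have h' := h.inf_left.map conn
  obtain ⟨s, hs, hle⟩ := h'
  refine ⟨s, hs, key.trans (sup_le (hle.trans (sup_le_sup_right ?_ _)) le_sup_left)⟩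
  rintro _ ⟨w, ⟨hw, hw'⟩, rfl⟩
  obtain ⟨_, ⟨y, rfl⟩, z, hz, rfl⟩ := Submodule.mem_sup.1 hw'
  obtain ⟨q1, q2⟩ := hS' _ _ hz
  obtain ⟨p1, p2⟩ := hS _ _ (mem_cyc.1 hw)
  have hc : cobd (cobd y + z) = cobd z := by rw [map_add, cobd_cobd, zero_add]
  have hd : conn (cobd y + z) = mulFn (headInd k S) (cobd z) := by
    rw [h_def, LinearMap.comp_apply, hc]
  rw [hc] at p1 p2
  rw [hd]
  set z₂ := mulFn (headInd k S') z
  rw [← add_sub_cancel (cobd z₂) (mulFn (headInd k S) (cobd z))]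
  refine Submodule.add_mem_sup ⟨_, rfl⟩ (mem_locZero_union ?_ ?_)
  · have e : mulFn (headInd k S) (cobd z) - cobd z₂ =
        cobd (z - z₂) - (cobd z - mulFn (headInd k S) (cobd z)) := by rw [map_sub]; ring
    rw [e]
    exact Submodule.sub_mem _ (cobd_mem_locZero q1) (locZero_anti hWV₁ p1)
  · exact Submodule.sub_mem _ (locZero_anti hWV₂ p2) (cobd_mem_locZero q2)

end Local

section Tame

variable {X : Type*} [TopologicalSpace X]

/-- The images of the restriction maps in cohomology from `U` to `V` have bounded total size, with
bounds which do not depend on the field of coefficients. -/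
def FiniteImage (U V : Set X) : Prop :=
  ∃ B D : ℕ, ∀ (k : Type) [Field k] (n : ℕ),
    GenMod (cyc k U n) (bdry k V n) B ∧ (D < n → cyc k U n ≤ bdry k V n)

/-- Every open neighbourhood of `K` contains a smaller one with finite restriction image. -/
def Tame (K : Set X) : Prop :=
  ∀ U, IsOpen U → K ⊆ U → ∃ V, IsOpen V ∧ K ⊆ V ∧ V ⊆ U ∧ FiniteImage U V

theorem FiniteImage.mono {U U' V V' : Set X} (h : FiniteImage U V) (hU : U ⊆ U') (hV : V' ⊆ V) :
    FiniteImage U' V' := by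
  obtain ⟨B, D, h⟩ := h
  exact ⟨B, D, fun k _ n => ⟨(h k n).1.mono (cyc_anti hU) (bdry_anti hV) le_rfl,
    fun hn => (cyc_anti hU).trans (((h k n).2 hn).trans (bdry_anti hV))⟩⟩

theorem Tame.union [T2Space X] [CompletelyNormalSpace X] {K₁ K₂ : Set X} (hc₁ : IsCompact K₁)
    (hc₂ : IsCompact K₂) (h₁ : Tame K₁) (h₂ : Tame K₂) (h₁₂ : Tame (K₁ ∩ K₂)) :
    Tame (K₁ ∪ K₂) := by
  intro U hU hKU
  obtain ⟨V₁, hV₁, hKV₁, hVU₁, B₁, D₁, hB₁⟩ := h₁ U hU (Set.subset_union_left.trans hKU)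
  obtain ⟨V₂, hV₂, hKV₂, hVU₂, B₂, D₂, hB₂⟩ := h₂ U hU (Set.subset_union_right.trans hKU)
  obtain ⟨W, hW, hKW, hWV, B, D, hB⟩ := h₁₂ (V₁ ∩ V₂) (hV₁.inter hV₂)
    (Set.inter_subset_inter hKV₁ hKV₂)
  have hd : Disjoint (K₁ \ W) (K₂ \ W) :=
    Set.disjoint_left.2 fun x hx hx' => hx.2 (hKW ⟨hx.1, hx'.1⟩)
  obtain ⟨O₁, O₂, hO₁, hO₂, hKO₁, hKO₂, hO⟩ :=
    SeparatedNhds.of_isCompact_isCompact (hc₁.diff hW) (hc₂.diff hW) hd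
  have hWW : (W ∪ O₁) ∩ V₁ ∩ ((W ∪ O₂) ∩ V₂) ⊆ W := by
    rintro x ⟨⟨hx | hx, -⟩, hx' | hx', -⟩
    · exact hx
    · exact hx
    · exact hx'
    · exact absurd hx' (Set.disjoint_left.1 hO hx)
  have hsub : ∀ {K O V : Set X}, K \ W ⊆ O → K ⊆ V → K ⊆ (W ∪ O) ∩ V := by
    refine fun {K O V} h h' x hx => ⟨?_, h' hx⟩
    by_cases hxW : x ∈ W
    · exact Or.inl hxW
    · exact Or.inr (h ⟨hx, hxW⟩)
  have hWO₁ := (hW.union hO₁).inter hV₁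
  have hWO₂ := (hW.union hO₂).inter hV₂
  refine ⟨_, hWO₁.union hWO₂, Set.union_subset_union (hsub hKO₁ hKV₁) (hsub hKO₂ hKV₂),
    Set.union_subset (Set.inter_subset_right.trans hVU₁) (Set.inter_subset_right.trans hVU₂),
    B₁ + B₂ + B + 1, D₁ + D₂ + D + 1, fun k _ n => ?_⟩
  cases n with
  | zero => exact ⟨(genMod_bdry_zero _).mono le_rfl le_rfl (by omega), by omega⟩
  | succ n =>
    refine ⟨(genMod_mayerVietoris hV₁ hV₂ hWO₁ hWO₂ Set.inter_subset_right Set.inter_subset_right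
      (hB₁ k (n + 1)).1 (hB₂ k (n + 1)).1
      ((hB k n).1.mono le_rfl (bdry_anti hWW) le_rfl)).mono le_rfl le_rfl (by omega), fun hn => ?_⟩
    exact genMod_zero_iff.1 (genMod_mayerVietoris (a := 0) (b := 0) (c := 0) hV₁ hV₂ hWO₁ hWO₂
      Set.inter_subset_right Set.inter_subset_right (GenMod.of_le ((hB₁ k (n + 1)).2 (by omega)))
      (GenMod.of_le ((hB₂ k (n + 1)).2 (by omega)))
      (GenMod.of_le (((hB k n).2 (by omega)).trans (bdry_anti hWW))))

theorem pull_sub_mem_bdry {k : Type*} [Field k] {V : Set X} {u v : X → X} {n : ℕ} {f : List X → k}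
    (h : ∀ x ∈ V, ∃ N ∈ nhds x, ∀ l : List X, l.length = n + 1 →
      (∀ y ∈ l, ∃ z ∈ N, y = u z ∨ y = v z) → cobd f l = 0) :
    pull v f - pull u f ∈ bdry k V n := by
  rw [← cobd_prism]
  refine Submodule.add_mem_sup ⟨_, rfl⟩ ⟨fun _ => rfl, fun x hx => ?_⟩
  obtain ⟨N, hN, h⟩ := h x hx
  refine ⟨N, hN, fun l hl hlN => prism_eq_zero fun l' hl' hs => h l' (by omega) fun y hy => ?_⟩
  have := hs hy
  simp only [List.mem_append, List.mem_map] at this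
  obtain ⟨z, hz, rfl⟩ | ⟨z, hz, rfl⟩ := this
  · exact ⟨z, hlN z hz, Or.inl rfl⟩
  · exact ⟨z, hlN z hz, Or.inr rfl⟩

theorem pull_const_mem_bdry {k : Type*} [Field k] {U V : Set X} {c : X} (hc : c ∈ U) {n : ℕ}
    (hn : n ≠ 0) {f : List X → k} (hf : f ∈ cyc k U n) :
    pull (fun _ : X => c) f ∈ bdry k V n := by
  set a := f (List.replicate n c) with ha
  have hagree : ∀ l : List X, l.length = n → (pull (fun _ : X => c) f - fun _ : List X => a : List X → k) l = 0 := by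
    intro l hl
    simp [ha, hl, List.map_const']
  have hloc : (pull (fun _ : X => c) f - fun _ : List X => a : List X → k) ∈ locZero k V n :=
    ⟨fun h => absurd h hn, fun x _ => ⟨Set.univ, Filter.univ_mem, fun l hl _ => hagree l hl⟩⟩
  rw [← sub_add_cancel (pull (fun _ : X => c) f) fun _ => a]
  refine Submodule.add_mem _ (Submodule.mem_sup_right hloc) ?_
  by_cases hodd : Odd n
  · rw [← sub_add_cancel (fun _ : List X => a) (cobd fun _ => a)]
    refine Submodule.add_mem _ (Submodule.mem_sup_right ?_) (Submodule.mem_sup_left ⟨_, rfl⟩)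
    refine ⟨fun h => absurd h hn, fun x _ => ⟨Set.univ, Filter.univ_mem, fun l hl _ => ?_⟩⟩
    simp [cobd_const, hl, hodd]
  · have h0 : a = 0 := by
      obtain ⟨N, hN, h⟩ := (mem_cyc.1 hf).2 c hc
      have h1 := h (List.replicate (n + 1) c) (by simp)
        fun y hy => by rw [List.eq_of_mem_replicate hy]; exact mem_of_mem_nhds hN
      have h2 : cobd (pull (fun _ : X => c) f - fun _ : List X => a : List X → k) (List.replicate (n + 1) c) = 0 :=
        cobd_eq_zero fun l' hl' _ => hagree l' (by simpa using hl')
      rw [map_sub, Pi.sub_apply, cobd_pull, pull_apply, cobd_const] at h2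
      simpa [h1, hodd, Nat.odd_add_one] using h2
    rw [h0]
    exact Submodule.zero_mem _

end Tame

section Convex

variable {X : Type*} [TopologicalSpace X] {E : Type*} [NormedAddCommGroup E] [NormedSpace ℝ E]

/-- The contraction in a chart onto the point with coordinates `c`. -/
noncomputable def contract (φ : OpenPartialHomeomorph X E) (c : E) (t : ℝ) (x : X) : X :=
  φ.symm ((1 - t) • φ x + t • c)

theorem cyc_le_bdry_of_convex (φ : OpenPartialHomeomorph X E) {L T : Set E} {U : Set X}
    (hT : Convex ℝ T) (hTL : T ⊆ L) (hL : IsCompact L) (hLt : L ⊆ φ.target)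
    (hLU : φ.symm '' L ⊆ U) {c : E} (hc : c ∈ T) (k : Type*) [Field k] {n : ℕ} (hn : n ≠ 0)
    (hTo : IsOpen T) :
    cyc k U n ≤ bdry k (φ.source ∩ φ ⁻¹' T) n := by
  intro f hf
  set V := φ.source ∩ φ ⁻¹' T with hV
  have hVo : IsOpen V := φ.isOpen_inter_preimage hTo
  have hcov : ∀ y : L, ∃ N : Set E, IsOpen N ∧ (y : E) ∈ N ∧
      ∀ l : List X, l.length = n + 1 → (∀ z ∈ l, ∃ w ∈ N, z = φ.symm w) → cobd f l = 0 := by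
    rintro ⟨y, hy⟩
    obtain ⟨N, hN, h⟩ := (mem_cyc.1 hf).2 (φ.symm y) (hLU ⟨y, hy, rfl⟩)
    have := (φ.continuousAt_symm (hLt hy)).preimage_mem_nhds hN
    obtain ⟨N', hN', hoN', hyN'⟩ := mem_nhds_iff.1 this
    refine ⟨N', hoN', hyN', fun l hl hlN => h l hl fun z hz => ?_⟩
    obtain ⟨w, hw, rfl⟩ := hlN z hz
    exact hN' hw
  choose N hNo hyN hN using hcov
  obtain ⟨η, hη, hball⟩ := lebesgue_number_lemma_of_metric hL hNo
    (fun y hy => Set.mem_iUnion.2 ⟨⟨y, hy⟩, hyN ⟨y, hy⟩⟩)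
  obtain ⟨R, hR⟩ := (hL.isBounded.subset hTL).subset_ball c
  obtain ⟨m, hm⟩ := exists_nat_gt (2 * R / η)
  have hRpos : 0 < R := by
    have := hR hc
    simpa using this
  have hmpos : (0 : ℝ) < m := lt_trans (by positivity) hm
  have hmem : ∀ x ∈ V, ∀ t ∈ Set.Icc (0 : ℝ) 1, (1 - t) • φ x + t • c ∈ T := fun x hx t ht =>
    hT hx.2 hc (by linarith [ht.2]) ht.1 (by ring)
  have hstep : ∀ i < m, pull (contract φ c ((i + 1 : ℕ) / m)) f - pull (contract φ c (i / m)) f ∈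
      bdry k V n := by
    intro i hi
    refine pull_sub_mem_bdry fun x hx => ?_
    have him : (i : ℝ) + 1 ≤ m := by exact_mod_cast hi
    have ht0 : (0 : ℝ) ≤ i / m := by positivity
    have ht1 : (i : ℝ) / m ≤ 1 := by rw [div_le_one hmpos]; linarith
    obtain ⟨j, hj⟩ := hball _ (hTL (hmem x hx (i / m) ⟨ht0, ht1⟩))
    have hnear : V ∩ (φ.source ∩ φ ⁻¹' Metric.ball (φ x) (η / 2)) ∈ nhds x :=
      Filter.inter_mem (hVo.mem_nhds hx) ((φ.isOpen_inter_preimage Metric.isOpen_ball).mem_nhds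
        ⟨hx.1, Metric.mem_ball_self (by positivity)⟩)
    refine ⟨_, hnear, fun l hl hlN => hN j l hl fun y hy => ?_⟩
    obtain ⟨z, ⟨hzV, -, hz⟩, rfl | rfl⟩ := hlN y hy
    · refine ⟨_, hj ?_, rfl⟩
      rw [Metric.mem_ball, dist_eq_norm]
      have e : (1 - (i : ℝ) / m) • φ z + ((i : ℝ) / m) • c -
          ((1 - (i : ℝ) / m) • φ x + ((i : ℝ) / m) • c) = (1 - (i : ℝ) / m) • (φ z - φ x) := by
        rw [smul_sub]; abel
      rw [e, norm_smul, Real.norm_of_nonneg (by linarith)]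
      have hz' : ‖φ z - φ x‖ < η / 2 := by simpa [dist_eq_norm] using hz
      nlinarith [norm_nonneg (φ z - φ x)]
    · refine ⟨_, hj ?_, rfl⟩
      rw [Metric.mem_ball, dist_eq_norm]
      have e : (1 - ((i + 1 : ℕ) : ℝ) / m) • φ z + (((i + 1 : ℕ) : ℝ) / m) • c -
          ((1 - (i : ℝ) / m) • φ x + ((i : ℝ) / m) • c) =
          (1 - (i : ℝ) / m) • (φ z - φ x) - (1 / m : ℝ) • (φ z - c) := by
        push_cast
        module
      rw [e]
      have hz' : ‖φ z - φ x‖ < η / 2 := by simpa [dist_eq_norm] using hz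
      have hzc : ‖φ z - c‖ < R := by simpa [dist_eq_norm] using hR hzV.2
      refine (norm_sub_le _ _).trans_lt ?_
      rw [norm_smul, norm_smul, Real.norm_of_nonneg (by linarith), Real.norm_of_nonneg (by positivity)]
      have h1 : (1 - (i : ℝ) / m) * ‖φ z - φ x‖ ≤ ‖φ z - φ x‖ := by
        nlinarith [norm_nonneg (φ z - φ x)]
      have h2 : (1 / m : ℝ) * ‖φ z - c‖ ≤ (1 / m : ℝ) * R :=
        mul_le_mul_of_nonneg_left hzc.le (by positivity)
      have h3 : (1 / m : ℝ) * R < η / 2 := by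
        rw [div_lt_iff₀ hη] at hm
        rw [one_div, inv_mul_lt_iff₀ hmpos]
        linarith
      linarith
  have htel : ∀ i ≤ m, pull (contract φ c (i / m)) f - pull (contract φ c 0) f ∈ bdry k V n := by
    intro i
    induction i with
    | zero => intro _; simp
    | succ i ih =>
      intro hi
      have := Submodule.add_mem _ (hstep i (by omega)) (ih (by omega))
      rwa [sub_add_sub_cancel] at this
  have h1 := htel m le_rfl
  rw [div_self hmpos.ne'] at h1
  have hconst : contract φ c 1 = fun _ => φ.symm c := by
    funext x; simp [contract]
  rw [hconst] at h1
  have h2 : pull (fun _ : X => φ.symm c) f ∈ bdry k V n :=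
    pull_const_mem_bdry (hLU ⟨c, hTL hc, rfl⟩) hn hf
  have h3 : pull (contract φ c 0) f - f ∈ bdry k V n := by
    refine Submodule.mem_sup_right ⟨fun h => absurd h hn, fun x hx =>
      ⟨V, hVo.mem_nhds hx, fun l _ hlV => ?_⟩⟩
    have : l.map (contract φ c 0) = l := by
      refine (List.map_congr_left fun y hy => ?_).trans (List.map_id l)
      simp [contract, φ.left_inv (hlV y hy).1]
    rw [Pi.sub_apply, pull_apply, this, sub_self]
  have : f = pull (fun _ : X => φ.symm c) f -
      (pull (fun _ : X => φ.symm c) f - pull (contract φ c 0) f) -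
      (pull (contract φ c 0) f - f) := by abel
  rw [this]
  exact Submodule.sub_mem _ (Submodule.sub_mem _ h2 h1) h3

theorem tame_convex [ProperSpace E] (φ : OpenPartialHomeomorph X E) {K : Set E} (hK : IsCompact K)
    (hc : Convex ℝ K) (hKt : K ⊆ φ.target) : Tame (φ.symm '' K) := by
  intro U hU hKU
  obtain ⟨ε, hε, hεU⟩ := hK.exists_cthickening_subset_open (φ.symm.isOpen_inter_preimage hU)
    (fun x hx => ⟨hKt hx, hKU ⟨x, hx, rfl⟩⟩)
  have hLU : φ.symm '' Metric.cthickening ε K ⊆ U := by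
    rintro _ ⟨x, hx, rfl⟩
    exact (hεU hx).2
  refine ⟨φ.source ∩ φ ⁻¹' Metric.thickening ε K, φ.isOpen_inter_preimage Metric.isOpen_thickening,
    ?_, ?_, 1, 0, fun k _ n => ?_⟩
  · rintro _ ⟨x, hx, rfl⟩
    refine ⟨φ.map_target (hKt hx), ?_⟩
    rw [Set.mem_preimage, φ.right_inv (hKt hx)]
    exact Metric.self_subset_thickening hε K hx
  · rintro x ⟨hx, hx'⟩
    have := hLU ⟨φ x, Metric.thickening_subset_cthickening _ _ hx', rfl⟩
    rwa [φ.left_inv hx] at this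
  · have key : n ≠ 0 → cyc k U n ≤ bdry k (φ.source ∩ φ ⁻¹' Metric.thickening ε K) n := by
      intro hn
      obtain rfl | ⟨c, hcK⟩ := K.eq_empty_or_nonempty
      · refine fun f _ => Submodule.mem_sup_right ⟨fun h => absurd h hn, ?_⟩
        simp
      · exact cyc_le_bdry_of_convex φ (hc.thickening ε) (Metric.thickening_subset_cthickening _ _)
          hK.cthickening (hεU.trans Set.inter_subset_left) hLU
          (Metric.self_subset_thickening hε K hcK) k hn Metric.isOpen_thickening
    refine ⟨?_, fun h => key h.ne'⟩
    obtain rfl | hn := eq_or_ne n 0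
    · exact genMod_bdry_zero _
    · exact GenMod.of_le (key hn)

end Convex

section Manifold

variable {X : Type*} [TopologicalSpace X]

theorem tame_empty : Tame (∅ : Set X) := by
  refine fun U _ _ => ⟨∅, isOpen_empty, le_rfl, Set.empty_subset U, 1, 0, fun k _ n => ?_⟩
  have key : n ≠ 0 → cyc k U n ≤ bdry k ∅ n := fun hn f _ =>
    Submodule.mem_sup_right ⟨fun h => absurd h hn, fun x hx => absurd hx (Set.notMem_empty x)⟩
  refine ⟨?_, fun h => key h.ne'⟩
  obtain rfl | hn := eq_or_ne n 0
  · exact genMod_bdry_zero _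
  · exact GenMod.of_le (key hn)

theorem isCompact_listUnion {l : List (Set X)} (h : ∀ K ∈ l, IsCompact K) :
    IsCompact (⋃ K ∈ l, K) := by
  have := (List.finite_toSet l).isCompact_biUnion (f := fun K => K) h
  simpa using this

theorem tame_listUnion [T2Space X] [CompletelyNormalSpace X] {C : Set (Set X)}
    (hC : ∀ K ∈ C, IsCompact K ∧ Tame K) (hi : ∀ K ∈ C, ∀ L ∈ C, K ∩ L ∈ C)
    (l : List (Set X)) (hl : ∀ K ∈ l, K ∈ C) : Tame (⋃ K ∈ l, K) := by
  induction hn : l.length generalizing l with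
  | zero =>
    obtain rfl := List.length_eq_zero_iff.1 hn
    simpa using tame_empty
  | succ n ih =>
    obtain ⟨a, l, rfl⟩ := List.exists_cons_of_length_eq_add_one hn
    have hl' : ∀ K ∈ l, K ∈ C := fun K hK => hl K (by simp [hK])
    have ha : a ∈ C := hl a (by simp)
    have e : ⋃ K ∈ a :: l, K = a ∪ ⋃ K ∈ l, K := by simp [Set.iUnion_or, Set.iUnion_union_distrib]
    have e' : a ∩ ⋃ K ∈ l, K = ⋃ K ∈ l.map (a ∩ ·), K := by
      simp [Set.inter_iUnion, Set.iUnion_exists]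
    rw [e]
    refine Tame.union (hC a ha).1 (isCompact_listUnion fun K hK => (hC K (hl' K hK)).1) (hC a ha).2
      (ih l hl' (by simpa using hn)) ?_
    rw [e']
    refine ih _ ?_ (by simpa using hn)
    intro K hK
    obtain ⟨L, hL, rfl⟩ := List.mem_map.1 hK
    exact hi a ha L (hl' L hL)

theorem tame_of_subset_source [T2Space X] [CompletelyNormalSpace X] {E : Type*}
    [NormedAddCommGroup E] [NormedSpace ℝ E] [ProperSpace E] (φ : OpenPartialHomeomorph X E)
    {K : Set X} (hK : IsCompact K) (hKs : K ⊆ φ.source) : Tame K := by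
  intro U hU hKU
  have hloc : ∀ x ∈ K, ∃ A : Set E, IsCompact A ∧ Convex ℝ A ∧ A ⊆ φ.target ∧ φ.symm '' A ⊆ U ∧
      φ.symm '' A ∈ nhds x := by
    intro x hx
    have hx' := φ.map_source (hKs hx)
    have ho := φ.symm.isOpen_inter_preimage hU
    obtain ⟨ε, hε, hεU⟩ := Metric.nhds_basis_closedBall.mem_iff.1
      (ho.mem_nhds (Set.mem_inter hx' (by simpa [φ.left_inv (hKs hx)] using hKU hx)))
    refine ⟨Metric.closedBall (φ x) ε, isCompact_closedBall _ _, convex_closedBall _ _,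
      hεU.trans Set.inter_subset_left, ?_, ?_⟩
    · rintro _ ⟨y, hy, rfl⟩
      exact (hεU hy).2
    · have := φ.symm.image_mem_nhds hx' (Metric.closedBall_mem_nhds (φ x) hε)
      rwa [φ.left_inv (hKs hx)] at this
  choose! A hAc hAv hAt hAU hAn using hloc
  obtain ⟨t, htK, hKt⟩ := hK.elim_nhds_subcover (fun x => φ.symm '' A x) hAn
  set l : List (Set X) := t.toList.map fun x => φ.symm '' A x with hl
  have hu : ⋃ L ∈ l, L = ⋃ x ∈ t, φ.symm '' A x := by
    simp [hl, Set.iUnion_exists]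
  have ht : Tame (⋃ L ∈ l, L) := by
    refine tame_listUnion (C := {L | ∃ B : Set E, IsCompact B ∧ Convex ℝ B ∧ B ⊆ φ.target ∧
      L = φ.symm '' B}) ?_ ?_ l ?_
    · rintro _ ⟨B, hB, hBv, hBt, rfl⟩
      exact ⟨hB.image_of_continuousOn (φ.continuousOn_symm.mono hBt), tame_convex φ hB hBv hBt⟩
    · rintro _ ⟨B, hB, hBv, hBt, rfl⟩ _ ⟨B', hB', hBv', hBt', rfl⟩
      refine ⟨B ∩ B', hB.inter hB', hBv.inter hBv', Set.inter_subset_left.trans hBt, ?_⟩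
      exact (φ.symm.injOn.image_inter hBt hBt').symm
    · intro L hL
      obtain ⟨x, hx, rfl⟩ := List.mem_map.1 hL
      have hx := htK x (by simpa using hx)
      exact ⟨A x, hAc x hx, hAv x hx, hAt x hx, rfl⟩
  rw [hu] at ht
  obtain ⟨V, hV, hKV, hVU, h⟩ := ht U hU (Set.iUnion₂_subset fun x hx => hAU x (htK x hx))
  exact ⟨V, hV, hKt.trans hKV, hVU, h⟩

/-- The cohomology of a compact manifold is finite, uniformly in the field of coefficients. -/
theorem finiteImage_univ [T2Space X] [CompletelyNormalSpace X] [CompactSpace X] {E : Type*}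
    [NormedAddCommGroup E] [NormedSpace ℝ E] [ProperSpace E] [ChartedSpace E X] :
    FiniteImage (Set.univ : Set X) Set.univ := by
  have hloc : ∀ x : X, ∃ A : Set X, IsCompact A ∧ A ⊆ (chartAt E x).source ∧ A ∈ nhds x := by
    intro x
    obtain ⟨A, hA, hxA, hAs⟩ := exists_compact_subset (chartAt E x).open_source
      (mem_chart_source E x)
    exact ⟨A, hA, hAs, mem_interior_iff_mem_nhds.1 hxA⟩
  choose A hAc hAs hAn using hloc
  obtain ⟨t, ht⟩ := CompactSpace.elim_nhds_subcover A hAn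
  have hu : ⋃ L ∈ t.toList.map A, L = Set.univ := by
    simpa [Set.iUnion_exists] using ht
  have h : Tame (⋃ L ∈ t.toList.map A, L) := by
    refine tame_listUnion (C := {L | IsCompact L ∧ ∃ x : X, L ⊆ (chartAt E x).source}) ?_ ?_ _ ?_
    · rintro L ⟨hL, x, hx⟩
      exact ⟨hL, tame_of_subset_source _ hL hx⟩
    · rintro L ⟨hL, x, hx⟩ L' ⟨hL', -⟩
      exact ⟨hL.inter hL', x, Set.inter_subset_left.trans hx⟩
    · intro L hL
      obtain ⟨x, -, rfl⟩ := List.mem_map.1 hL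
      exact ⟨hAc x, x, hAs x⟩
  rw [hu] at h
  obtain ⟨V, -, hV, -, hfin⟩ := h _ isOpen_univ le_rfl
  rwa [Set.univ_subset_iff.1 hV] at hfin

end Manifold

section Action

variable {X E : Type*} [CommGroup E] [MulAction E X] (k : Type*) [Field k]

/-- The action of a group element on cochains. -/
def act (a : E) : Module.End k (List X → k) := pull (a • ·)

variable (X) in
/-- Cochains invariant under a subgroup. -/
def inv (F : Subgroup E) : Submodule k (List X → k) where
  carrier := {f | ∀ a ∈ F, act k a f = f}
  zero_mem' := by simp
  add_mem' hf hg a ha := by rw [map_add, hf a ha, hg a ha]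
  smul_mem' c f hf a ha := by rw [map_smul, hf a ha]

/-- Lists all of whose entries are fixed by a common element of the coset `g F`. -/
def fixL (F : Subgroup E) (g : E) : Set (List X) := {l | ∃ a ∈ F, ∀ x ∈ l, (g * a) • x = x}

variable (X) in
/-- Cochains which vanish on `fixL F g`. -/
def van (F : Subgroup E) (g : E) : Submodule k (List X → k) where
  carrier := {f | ∀ l ∈ fixL F g, f l = 0}
  zero_mem' := by simp
  add_mem' hf hg l hl := by simp [hf l hl, hg l hl]
  smul_mem' c f hf l hl := by simp [hf l hl]

variable {k} {F : Subgroup E} {g : E} {f : List X → k}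

theorem act_apply (a : E) (f : List X → k) (l : List X) : act k a f l = f (l.map (a • ·)) := rfl

theorem map_smul_map_smul (a b : E) (l : List X) :
    (l.map (a • ·)).map (b • ·) = l.map ((b * a) • ·) := by simp [mul_smul]

theorem act_mul (a b : E) : act (X := X) k (a * b) = act k a * act k b := by
  ext f l
  rw [Module.End.mul_apply, act_apply, act_apply, act_apply, map_smul_map_smul, mul_comm a b]

theorem act_one : act (X := X) k (1 : E) = 1 := by
  ext f l; simp [act_apply]

theorem act_pow (a : E) (i : ℕ) : act (X := X) k (a ^ i) = act k a ^ i := by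
  induction i with
  | zero => simp [act_one]
  | succ i ih => rw [pow_succ, pow_succ, act_mul, ih]

theorem act_commute (a b : E) : Commute (act (X := X) k a) (act k b) := by
  rw [Commute, SemiconjBy, ← act_mul, ← act_mul, mul_comm]

theorem mem_inv : f ∈ inv X k F ↔ ∀ a ∈ F, act k a f = f := Iff.rfl

theorem mem_van : f ∈ van X k F g ↔ ∀ l ∈ fixL F g, f l = 0 := Iff.rfl

theorem inv_of_commute {φ : Module.End k (List X → k)} (h : ∀ a : E, Commute φ (act k a))
    (hf : f ∈ inv X k F) : φ f ∈ inv X k F := fun a ha => by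
  rw [← Module.End.mul_apply, ← h a, Module.End.mul_apply, hf a ha]

theorem nil_mem_fixL : [] ∈ fixL (X := X) F g := ⟨1, F.one_mem, by simp⟩

theorem fixL_of_subset {l l' : List X} (h : l ∈ fixL F g) (hs : l' ⊆ l) : l' ∈ fixL F g := by
  obtain ⟨a, ha, h⟩ := h
  exact ⟨a, ha, fun x hx => h x (hs hx)⟩

theorem fixL_map {l : List X} (h : l ∈ fixL F g) (b : E) : l.map (b • ·) ∈ fixL F g := by
  obtain ⟨a, ha, h⟩ := h
  refine ⟨a, ha, fun x hx => ?_⟩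
  obtain ⟨y, hy, rfl⟩ := List.mem_map.1 hx
  rw [smul_comm, h y hy]

theorem fixL_map_iff {l : List X} (b : E) : l.map (b • ·) ∈ fixL F g ↔ l ∈ fixL F g := by
  refine ⟨fun h => ?_, fun h => fixL_map h b⟩
  have := fixL_map h b⁻¹
  rw [map_smul_map_smul, inv_mul_cancel] at this
  simpa using this

theorem act_eq_of_mem_fixL {l : List X} (hl : l ∈ fixL F g) (hf : f ∈ inv X k F) :
    act k g f l = f l := by
  obtain ⟨a, ha, h⟩ := hl
  have h1 := congrFun (hf a ha) (l.map (g • ·))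
  rw [act_apply, map_smul_map_smul, mul_comm] at h1
  rw [act_apply, ← h1]
  congr 1
  exact (List.map_congr_left h).trans (List.map_id l)

theorem van_act (hf : f ∈ van X k F g) (b : E) : act k b f ∈ van X k F g :=
  fun _ hl => hf _ (fixL_map hl b)

theorem cobd_commute_act (a : E) : Commute (cobd : Module.End k (List X → k)) (act k a) :=
  LinearMap.ext fun f => cobd_pull _ f

theorem prism_commute_act {h : X → X} (hh : ∀ (a : E) x, h (a • x) = a • h x) (a : E) :
    Commute (prism id h : Module.End k (List X → k)) (act k a) :=
  LinearMap.ext fun f => prism_pull (u := id) (v := h) (w := (a • ·)) (fun _ => rfl) (hh a) f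

theorem pull_commute_act {h : X → X} (hh : ∀ (a : E) x, h (a • x) = a • h x) (a : E) :
    Commute (pull h : Module.End k (List X → k)) (act k a) := by
  refine LinearMap.ext fun f => ?_
  simp only [Module.End.mul_apply, act, pull_pull]
  congr 1
  congr 1
  funext x
  exact (hh a x).symm

theorem mulFn_commute_act {w : List X → k} {a : E} (hw : act k a w = w) :
    Commute (mulFn w : Module.End k (List X → k)) (act k a) := by
  refine LinearMap.ext fun f => funext fun l => ?_
  have := congrFun hw l
  simp only [Module.End.mul_apply, mulFn_apply, act_apply] at this ⊢
  rw [this]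

theorem cobd_mem_inv (hf : f ∈ inv X k F) : cobd f ∈ inv X k F :=
  inv_of_commute (φ := cobd) cobd_commute_act hf

theorem cobd_mem_van (hf : f ∈ van X k F g) : cobd f ∈ van X k F g :=
  fun _ hl => cobd_eq_zero fun _ _ hs => hf _ (fixL_of_subset hl hs)

theorem mulFn_mem_van (w : List X → k) (hf : f ∈ van X k F g) : mulFn w f ∈ van X k F g :=
  fun l hl => by simp [hf l hl]

end Action

section Pair

variable {X E : Type*} [CommGroup E]

/-- The conditions on a group action under which Smith theory is applied. -/
structure SmithHyp (E X : Type*) [CommGroup E] [MulAction E X] (p : ℕ) : Prop where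
  prime : p.Prime
  pow : ∀ g : E, g ^ p = 1
  stab : ∀ (a b : E) (x : X), a ≠ 1 → a • x = x → b • x = x → b ∈ Subgroup.zpowers a

variable {k : Type*} [Field k] {p : ℕ} {F : Subgroup E} {g : E}

/-- A pair of operators as in Smith theory: each is surjective onto the kernel of the other, away
from the fixed points. -/
structure SmithPair (X k : Type*) [Field k] [MulAction E X] (p : ℕ) (F : Subgroup E) (g : E)
    (α β : Module.End k (List X → k)) : Prop where
  comm : ∀ φ : Module.End k (List X → k), Commute φ (act k g) → Commute φ α
  stable : ∀ S : Submodule k (List X → k), (∀ f ∈ S, act k g f ∈ S) → ∀ f ∈ S, α f ∈ S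
  mem_van : ∀ f ∈ inv X k F, α f ∈ van X k F g
  comp : ∀ f, β (α f) = 0
  exists_section : ∀ e : List X → k,
    (∀ l ∉ fixL F g, ∑ i ∈ Finset.range p, e (l.map (g ^ i • ·)) = 1) →
    ∃ s : Module.End k (List X → k),
      (∀ S : Submodule k (List X → k), (∀ f ∈ S, act k g f ∈ S) → (∀ f ∈ S, mulFn e f ∈ S) →
        ∀ f ∈ S, s f ∈ S) ∧
      ∀ f ∈ van X k F g, β f = 0 → α (s f) = f

variable [MulAction E X]

variable (X k) in
/-- The difference operator of Smith theory. -/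
def smithDiff (g : E) : Module.End k (List X → k) := 1 - act k g

variable (X k) in
/-- The norm operator of Smith theory. -/
def smithNorm (p : ℕ) (g : E) : Module.End k (List X → k) :=
  ∑ i ∈ Finset.range p, act k g ^ i

theorem smithDiff_apply (f : List X → k) (l : List X) :
    smithDiff X k g f l = f l - act k g f l := rfl

theorem smithNorm_apply (f : List X → k) (l : List X) :
    smithNorm X k p g f l = ∑ i ∈ Finset.range p, f (l.map (g ^ i • ·)) := by
  simp [smithNorm, ← act_pow, act_apply]

theorem pow_act_mem {S : Submodule k (List X → k)} (hS : ∀ f ∈ S, act k g f ∈ S) (i : ℕ)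
    {f : List X → k} (hf : f ∈ S) : (act k g ^ i) f ∈ S := by
  induction i with
  | zero => simpa using hf
  | succ i ih => rw [pow_succ', Module.End.mul_apply]; exact hS _ ih

theorem smithDiff_mul_smithNorm (hg : g ^ p = 1) :
    smithDiff X k g * smithNorm X k p g = 0 := by
  rw [smithDiff, smithNorm, mul_neg_geom_sum, ← act_pow, hg, act_one, sub_self]

theorem smithNorm_mul_smithDiff (hg : g ^ p = 1) :
    smithNorm X k p g * smithDiff X k g = 0 := by
  rw [smithDiff, smithNorm, geom_sum_mul_neg, ← act_pow, hg, act_one, sub_self]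

theorem act_pow_eq_of_mem_fixL {f : List X → k} {l : List X} (hl : l ∈ fixL F g)
    (hf : f ∈ inv X k F) (i : ℕ) : f (l.map (g ^ i • ·)) = f l := by
  induction i with
  | zero => simp
  | succ i ih =>
    have := act_eq_of_mem_fixL (fixL_map hl (g ^ i)) hf
    rw [act_apply, map_smul_map_smul, ← pow_succ'] at this
    rw [this, ih]

theorem smithPair_norm_diff (hg : g ^ p = 1) (hp : (p : k) = 0) :
    SmithPair X k p F g (smithNorm X k p g) (smithDiff X k g) where
  comm φ h := Commute.sum_right _ _ _ fun i _ => h.pow_right i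
  stable S hS f hf := by
    rw [smithNorm, LinearMap.sum_apply]
    exact Submodule.sum_mem _ fun i _ => pow_act_mem hS i hf
  mem_van f hf l hl := by
    rw [smithNorm_apply, Finset.sum_congr rfl fun i _ => act_pow_eq_of_mem_fixL hl hf i]
    simp [hp]
  comp f := by
    rw [← Module.End.mul_apply, smithDiff_mul_smithNorm hg, LinearMap.zero_apply]
  exists_section e he := by
    refine ⟨mulFn e, fun S _ h => h, fun f hf h => ?_⟩
    have hinv : ∀ (i : ℕ) (l : List X), f (l.map (g ^ i • ·)) = f l := by
      intro i l
      induction i with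
      | zero => simp
      | succ i ih =>
        have := congrFun h (l.map (g ^ i • ·))
        rw [smithDiff_apply, act_apply, map_smul_map_smul, ← pow_succ', ih] at this
        exact (sub_eq_zero.1 this).symm
    funext l
    rw [smithNorm_apply]
    simp only [mulFn_apply, hinv]
    rw [← Finset.sum_mul]
    by_cases hl : l ∈ fixL F g
    · simp [hf l hl]
    · rw [he l hl, one_mul]

theorem smithPair_diff_norm (hg : g ^ p = 1) :
    SmithPair X k p F g (smithDiff X k g) (smithNorm X k p g) where
  comm φ h := (Commute.one_right φ).sub_right h
  stable S hS f hf := Submodule.sub_mem _ hf (hS f hf)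
  mem_van f hf l hl := by
    rw [smithDiff_apply, act_eq_of_mem_fixL hl hf, sub_self]
  comp f := by
    rw [← Module.End.mul_apply, smithNorm_mul_smithDiff hg, LinearMap.zero_apply]
  exists_section e he := by
    refine ⟨∑ i ∈ Finset.range p, act k g ^ i * mulFn e * act k g ^ (p - i) *
      ∑ t ∈ Finset.range i, act k g ^ t, fun S hS he f hf => ?_, fun f hf h => ?_⟩
    · rw [LinearMap.sum_apply]
      refine Submodule.sum_mem _ fun i _ => ?_
      simp only [Module.End.mul_apply]
      refine pow_act_mem hS i (he _ (pow_act_mem hS _ ?_))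
      rw [LinearMap.sum_apply]
      exact Submodule.sum_mem _ fun i _ => pow_act_mem hS i hf
    · set s : Module.End k (List X → k) := ∑ i ∈ Finset.range p, act k g ^ i * mulFn e *
        act k g ^ (p - i) * ∑ t ∈ Finset.range i, act k g ^ t with hs
      have hsl : ∀ l, s f l = ∑ i ∈ Finset.range p, e (l.map (g ^ i • ·)) *
          ∑ t ∈ Finset.range i, f (l.map (g ^ t • ·)) := by
        intro l
        rw [hs, LinearMap.sum_apply, Finset.sum_apply]
        refine Finset.sum_congr rfl fun i hi => ?_
        simp only [Module.End.mul_apply, ← act_pow]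
        rw [act_apply, mulFn_apply, act_apply, map_smul_map_smul, ← pow_add,
          Nat.sub_add_cancel (Finset.mem_range.1 hi).le, hg]
        simp [act_apply]
      funext l
      have hP : ∑ t ∈ Finset.range p, f (l.map (g ^ t • ·)) = 0 := by
        rw [← smithNorm_apply, h]; rfl
      rw [smithDiff_apply, act_apply, hsl, hsl]
      simp only [map_smul_map_smul, ← pow_succ]
      have h1 : ∀ i, ∑ t ∈ Finset.range i, f (l.map (g ^ (t + 1) • ·)) =
          ∑ t ∈ Finset.range (i + 1), f (l.map (g ^ t • ·)) - f l := by
        intro i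
        rw [Finset.sum_range_succ' _ i]; simp
      simp only [h1]
      have h2 := Finset.sum_range_succ' (fun i => e (l.map (g ^ i • ·)) *
        (∑ t ∈ Finset.range i, f (l.map (g ^ t • ·)) - f l)) p
      rw [Finset.sum_range_succ, hP, hg] at h2
      simp only [one_smul, pow_zero, Finset.range_zero, Finset.sum_empty, zero_sub,
        List.map_id'] at h2
      rw [← add_right_cancel h2, ← Finset.sum_sub_distrib]
      simp only [← mul_sub, sub_sub_cancel]
      rw [← Finset.sum_mul]
      by_cases hl : l ∈ fixL F g
      · simp [hf l hl]
      · rw [he l hl, one_mul]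

theorem mem_fixL_of_zpow (hyp : SmithHyp E X p) {l : List X} {m : ℤ} (hm : ¬ (p : ℤ) ∣ m) {a : E}
    (ha : a ∈ F) (h : ∀ x ∈ l, (g ^ m * a) • x = x) : l ∈ fixL F g := by
  have hco : IsCoprime (p : ℤ) m :=
    (Nat.prime_iff_prime_int.1 hyp.prime).coprime_iff_not_dvd.2 hm
  obtain ⟨u, v, huv⟩ := hco
  refine ⟨a ^ v, F.zpow_mem ha v, fun x hx => ?_⟩
  have e : g * a ^ v = (g ^ m * a) ^ v := by
    rw [mul_zpow, ← zpow_mul, show m * v = 1 - p * u by linarith, zpow_sub, zpow_one, zpow_mul,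
      zpow_natCast, hyp.pow, one_zpow, inv_one, mul_one]
  rw [e]
  have : g ^ m * a ∈ MulAction.stabilizer E x := h x hx
  exact Subgroup.zpow_mem _ this v

theorem SmithHyp.exists_eq_mul_pow (hyp : SmithHyp E X p) {c : E}
    (hc : c ∈ F ⊔ Subgroup.zpowers g) : ∃ a ∈ F, ∃ j < p, c = a * g ^ j := by
  obtain ⟨a, ha, z, hz, rfl⟩ := Subgroup.mem_sup.1 hc
  obtain ⟨m, rfl⟩ := Subgroup.mem_zpowers_iff.1 hz
  have hp : (0 : ℤ) < p := by exact_mod_cast hyp.prime.pos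
  obtain ⟨j, hj⟩ := Int.eq_ofNat_of_zero_le (Int.emod_nonneg m hp.ne')
  refine ⟨a, ha, j, ?_, ?_⟩
  · have := Int.emod_lt_of_pos m hp
    omega
  · rw [← zpow_natCast g j, ← hj, Int.emod_def, zpow_sub, zpow_mul, zpow_natCast g p, hyp.pow,
      one_zpow, inv_one, mul_one]

open Classical in
/-- There is a cochain which sums to one along every orbit of `g` outside `fixL F g`. -/
theorem exists_orbit_weight (hyp : SmithHyp E X p) (k : Type*) [Field k] (F : Subgroup E) (g : E) :
    ∃ e ∈ inv X k F, ∀ l ∉ fixL F g, ∑ i ∈ Finset.range p, e (l.map (g ^ i • ·)) = 1 := by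
  let r : Setoid (List X) :=
    { r := fun l l' => ∃ c ∈ F ⊔ Subgroup.zpowers g, l.map (c • ·) = l'
      iseqv :=
        { refl := fun l => ⟨1, Subgroup.one_mem _, by simp⟩
          symm := by
            rintro l _ ⟨c, hc, rfl⟩
            refine ⟨c⁻¹, Subgroup.inv_mem _ hc, ?_⟩
            rw [map_smul_map_smul, inv_mul_cancel]; simp
          trans := by
            rintro l _ _ ⟨c, hc, rfl⟩ ⟨d, hd, rfl⟩
            exact ⟨d * c, Subgroup.mul_mem _ hd hc, (map_smul_map_smul _ _ _).symm⟩ } }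
  have hout : ∀ (l : List X), ∀ c ∈ F ⊔ Subgroup.zpowers g,
      (Quotient.mk r (l.map (c • ·))).out = (Quotient.mk r l).out := fun l c hc =>
    congrArg Quotient.out (Quotient.sound (s := r) (r.symm ⟨c, hc, rfl⟩))
  have hFle : F ≤ F ⊔ Subgroup.zpowers g := le_sup_left
  have hgle : ∀ i : ℕ, g ^ i ∈ F ⊔ Subgroup.zpowers g := fun i =>
    Subgroup.pow_mem _ ((le_sup_right : _ ≤ F ⊔ Subgroup.zpowers g) (Subgroup.mem_zpowers g)) i
  refine ⟨fun l => if ∃ a ∈ F, l.map (a • ·) = (Quotient.mk r l).out then 1 else 0, ?_, ?_⟩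
  · intro b hb
    funext l
    rw [act_apply, hout l b (hFle hb)]
    refine if_congr ⟨?_, ?_⟩ rfl rfl
    · rintro ⟨a, ha, h⟩
      exact ⟨a * b, F.mul_mem ha hb, by rw [← h, map_smul_map_smul]⟩
    · rintro ⟨a, ha, h⟩
      exact ⟨a * b⁻¹, F.mul_mem ha (F.inv_mem hb), by
        rw [← h, map_smul_map_smul, inv_mul_cancel_right]⟩
  · intro l hl
    obtain ⟨c, hc, hcl⟩ : ∃ c ∈ F ⊔ Subgroup.zpowers g, l.map (c • ·) = (Quotient.mk r l).out :=
      r.symm (Quotient.exact (Quotient.out_eq (Quotient.mk r l)))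
    obtain ⟨a, ha, j, hjp, rfl⟩ := hyp.exists_eq_mul_pow hc
    rw [Finset.sum_eq_single_of_mem j (Finset.mem_range.2 hjp)]
    · refine if_pos ⟨a, ha, ?_⟩
      rw [hout l _ (hgle j), map_smul_map_smul, hcl]
    · intro i hi hij
      refine if_neg ?_
      rintro ⟨b, hb, h⟩
      rw [hout l _ (hgle i), map_smul_map_smul, ← hcl] at h
      refine hl (mem_fixL_of_zpow hyp (m := (i : ℤ) - j) ?_ (F.mul_mem hb (F.inv_mem ha)) ?_)
      · intro hd
        have h1 := Finset.mem_range.1 hi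
        have := Int.eq_zero_of_abs_lt_dvd hd (abs_sub_lt_iff.2 ⟨by omega, by omega⟩)
        omega
      · intro x hx
        have := List.map_inj_left.1 h x hx
        have e : g ^ ((i : ℤ) - j) * (b * a⁻¹) = (a * g ^ j)⁻¹ * (b * g ^ i) := by
          rw [zpow_sub, zpow_natCast, zpow_natCast, mul_inv]
          simp only [mul_comm, mul_left_comm, mul_assoc]
        rw [e, mul_smul, this, inv_smul_smul]

end Pair

theorem GenMod.sup_left {k F : Type*} [Field k] [AddCommGroup F] [Module k F]
    {A B C : Submodule k F} {m : ℕ} (h : GenMod A B m) (hC : C ≤ B) : GenMod (A ⊔ C) B m := by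
  obtain ⟨s, hs, h⟩ := h
  exact ⟨s, hs, sup_le h (le_sup_of_le_left hC)⟩

section Small

variable {X : Type*} [MetricSpace X] {k : Type*} [Field k]

/-- Lists of points at pairwise distance less than `ε`. -/
def Small (ε : ℝ) (l : List X) : Prop := ∀ x ∈ l, ∀ y ∈ l, dist x y < ε

theorem Small.mono {ε ε' : ℝ} {l l' : List X} (h : Small ε l) (hs : l' ⊆ l) (he : ε ≤ ε') :
    Small ε' l' := fun x hx y hy => (h x (hs hx) y (hs hy)).trans_le he

theorem mem_locZero_univ_of_small {n : ℕ} {f : List X → k} {ε : ℝ} (hε : 0 < ε)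
    (h : ∀ l, l.length = n → Small ε l → f l = 0) : f ∈ locZero k Set.univ n := by
  refine ⟨fun hn => h [] hn.symm (by simp [Small]), fun x _ =>
    ⟨Metric.ball x (ε / 2), Metric.ball_mem_nhds x (by positivity), fun l hl hN => h l hl ?_⟩⟩
  intro y hy z hz
  have h1 := Metric.mem_ball.1 (hN y hy)
  have h2 := Metric.mem_ball.1 (hN z hz)
  have := dist_triangle_right y z x
  linarith

theorem exists_small_of_mem_locZero_univ [CompactSpace X] {n : ℕ} {f : List X → k}
    (hf : f ∈ locZero k Set.univ n) :
    ∃ ε > 0, ∀ l : List X, l.length = n → Small ε l → f l = 0 := by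
  have hcov : ∀ x : X, ∃ N : Set X, IsOpen N ∧ x ∈ N ∧
      ∀ l : List X, l.length = n → (∀ y ∈ l, y ∈ N) → f l = 0 := by
    intro x
    obtain ⟨N, hN, h⟩ := hf.2 x trivial
    obtain ⟨N', hN', ho, hx⟩ := mem_nhds_iff.1 hN
    exact ⟨N', ho, hx, fun l hl hlN => h l hl fun y hy => hN' (hlN y hy)⟩
  choose N hNo hxN hN using hcov
  obtain ⟨ε, hε, hball⟩ := lebesgue_number_lemma_of_metric (isCompact_univ (X := X)) hNo
    (fun x _ => Set.mem_iUnion.2 ⟨x, hxN x⟩)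
  refine ⟨ε, hε, fun l hl hs => ?_⟩
  cases l with
  | nil => exact hf.1 (by simpa using hl.symm)
  | cons x l =>
    obtain ⟨i, hi⟩ := hball x trivial
    exact hN i _ hl fun y hy => hi (hs y hy x (by simp))

end Small

section Smith

variable {X E : Type*} [CommGroup E] [MulAction E X]
  {k : Type*} [Field k] {p : ℕ} {F : Subgroup E} {g : E} {n : ℕ} {f : List X → k}
  {α β : Module.End k (List X → k)}

variable (X k) in
/-- The kernel of `α` on the invariant cochains vanishing on the fixed points. -/
def smithSub (F : Subgroup E) (g : E) (α : Module.End k (List X → k)) :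
    Submodule k (List X → k) :=
  inv X k F ⊓ van X k F g ⊓ LinearMap.ker α

theorem act_mem_inv (hf : f ∈ inv X k F) (a : E) : act k a f ∈ inv X k F :=
  inv_of_commute (fun b => act_commute a b) hf

theorem mulFn_mem_inv {w : List X → k} (hw : w ∈ inv X k F) (hf : f ∈ inv X k F) :
    mulFn w f ∈ inv X k F := by
  intro a ha
  funext l
  have h1 := congrFun (hw a ha) l
  have h2 := congrFun (hf a ha) l
  simp only [act_apply, mulFn_apply] at h1 h2 ⊢
  rw [h1, h2]

theorem SmithPair.map_mem_smithSub (hα : SmithPair X k p F g α β) (hf : f ∈ inv X k F) :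
    α f ∈ smithSub X k F g β :=
  ⟨⟨hα.stable _ (fun _ h => act_mem_inv h g) _ hf, hα.mem_van f hf⟩, hα.comp f⟩

theorem SmithPair.cobd_comm (hα : SmithPair X k p F g α β) (f : List X → k) :
    cobd (α f) = α (cobd f) :=
  LinearMap.congr_fun (hα.comm cobd (cobd_commute_act g)) f

theorem cobd_mem_smithSub (hα : SmithPair X k p F g α β) (hf : f ∈ smithSub X k F g α) :
    cobd f ∈ smithSub X k F g α := by
  refine ⟨⟨cobd_mem_inv hf.1.1, cobd_mem_van hf.1.2⟩, ?_⟩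
  change α (cobd f) = 0
  rw [← hα.cobd_comm, LinearMap.mem_ker.1 hf.2, map_zero]

section

variable [TopologicalSpace X]

/-- The cohomology in degree `n` of a subcomplex of cochains has dimension at most `b`. -/
def CohRank (I : Submodule k (List X → k)) (n b : ℕ) : Prop :=
  GenMod (I ⊓ cyc k Set.univ n) (I.map cobd ⊔ locZero k Set.univ n) b

theorem act_mem_locZero [ContinuousConstSMul E X] {O : Set X} {a : E} (ha : ∀ x ∈ O, a • x ∈ O)
    (hf : f ∈ locZero k O n) : act k a f ∈ locZero k O n := by
  refine ⟨fun h => hf.1 h, fun x hx => ?_⟩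
  obtain ⟨N, hN, h⟩ := hf.2 _ (ha x hx)
  refine ⟨_, (continuous_const_smul a).continuousAt.preimage_mem_nhds hN, fun l hl hlN =>
    h _ (by simpa using hl) fun y hy => ?_⟩
  obtain ⟨z, hz, rfl⟩ := List.mem_map.1 hy
  exact hlN z hz

theorem mulFn_mem_locZero {O : Set X} (w : List X → k) (hf : f ∈ locZero k O n) :
    mulFn w f ∈ locZero k O n := by
  refine ⟨fun h => by simp [hf.1 h], fun x hx => ?_⟩
  obtain ⟨N, hN, h⟩ := hf.2 x hx
  exact ⟨N, hN, fun l hl hlN => by simp [h l hl hlN]⟩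

theorem CohRank.sup {I : Submodule k (List X → k)} {c : ℕ} (h : CohRank I n c) :
    GenMod ((I ⊓ cyc k Set.univ n) ⊔ locZero k Set.univ n)
      (I.map cobd ⊔ locZero k Set.univ n) c := h.sup_left le_sup_right

theorem map_mem_map_of_cobd_mem (hf : f ∈ inv X k F)
    (h : cobd f ∈ (smithSub X k F g α).map cobd ⊔ locZero k Set.univ (n + 1)) :
    α f ∈ (inv X k F ⊓ cyc k Set.univ n).map α := by
  obtain ⟨_, ⟨ψ, hψ, rfl⟩, z, hz, e⟩ := Submodule.mem_sup.1 h
  refine ⟨f - ψ, ⟨Submodule.sub_mem _ hf hψ.1.1, ?_⟩, ?_⟩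
  · change cobd (f - ψ) ∈ locZero k Set.univ (n + 1)
    rw [map_sub, ← e, add_sub_cancel_left]
    exact hz
  · rw [map_sub, LinearMap.mem_ker.1 hψ.2, sub_zero]

end

variable [MetricSpace X] [CompactSpace X] [IsIsometricSMul E X]

open Classical in
theorem mem_smithSub_sup_of_map_mem (hα : SmithPair X k p F g α β) (hf : f ∈ inv X k F)
    (hv : f ∈ van X k F g ⊔ locZero k Set.univ n) (h : α f ∈ locZero k Set.univ n) :
    f ∈ smithSub X k F g α ⊔ locZero k Set.univ n := by
  obtain ⟨v, hv', z, hz, rfl⟩ := Submodule.mem_sup.1 hv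
  obtain ⟨ε₁, hε₁, h₁⟩ := exists_small_of_mem_locZero_univ h
  obtain ⟨ε₂, hε₂, h₂⟩ := exists_small_of_mem_locZero_univ hz
  set ε := min ε₁ ε₂
  set w : List X → k := fun l => if l.length = n ∧ Small ε l then 1 else 0 with hw
  have hact : ∀ a : E, act k a w = w := by
    intro a
    funext l
    refine if_congr ?_ rfl rfl
    simp only [Small, List.length_map, List.forall_mem_map, dist_smul]
  have hz0 : mulFn w z = 0 := by
    funext l
    by_cases hl : l.length = n ∧ Small ε l
    · simp [h₂ l hl.1 (hl.2.mono (List.Subset.refl l) (min_le_right _ _))]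
    · simp [hw, hl]
  have hα0 : α (mulFn w (v + z)) = 0 := by
    have := LinearMap.congr_fun (hα.comm (mulFn w) (mulFn_commute_act (hact g))) (v + z)
    simp only [Module.End.mul_apply] at this
    rw [← this]
    funext l
    by_cases hl : l.length = n ∧ Small ε l
    · rw [mulFn_apply, h₁ l hl.1 (hl.2.mono (List.Subset.refl l) (min_le_left _ _)), mul_zero]; rfl
    · simp [hw, hl]
  rw [← add_sub_cancel (mulFn w (v + z)) (v + z)]
  refine Submodule.add_mem_sup ⟨⟨mulFn_mem_inv (fun a _ => hact a) hf, ?_⟩, hα0⟩ ?_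
  · rw [map_add, hz0, add_zero]
    exact mulFn_mem_van w hv'
  · refine mem_locZero_univ_of_small (ε := ε) (lt_min hε₁ hε₂) fun l hl hs => ?_
    simp [hw, hl, hs]

end Smith

section Sequences

variable {X E : Type*} [CommGroup E] [MulAction E X]
  {k : Type*} [Field k] {p : ℕ} {F : Subgroup E} {g : E} {n : ℕ} {f : List X → k}
  {α β : Module.End k (List X → k)}

theorem SmithPair.map_inv_map_cobd (hα : SmithPair X k p F g α β) :
    ((inv X k F).map cobd).map α ≤ (smithSub X k F g β).map cobd := by
  rintro _ ⟨_, ⟨f, hf, rfl⟩, rfl⟩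
  exact ⟨α f, hα.map_mem_smithSub hf, hα.cobd_comm f⟩

open Classical in
/-- Restriction of cochains to the lists fixed by an element of the coset `g F`. -/
noncomputable def restrictFix (k : Type*) [Field k] (F : Subgroup E) (g : E) :
    Module.End k (List X → k) := mulFn fun l => if l ∈ fixL F g then 1 else 0

theorem restrictFix_of_mem {l : List X} (hl : l ∈ fixL F g) (f : List X → k) :
    restrictFix k F g f l = f l := by simp [restrictFix, hl]

theorem restrictFix_of_notMem {l : List X} (hl : l ∉ fixL F g) (f : List X → k) :
    restrictFix k F g f l = 0 := by simp [restrictFix, hl]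

theorem act_restrictFix (a : E) (f : List X → k) :
    act k a (restrictFix k F g f) = restrictFix k F g (act k a f) := by
  funext l
  by_cases hl : l ∈ fixL F g
  · rw [act_apply, restrictFix_of_mem hl, restrictFix_of_mem ((fixL_map_iff a).2 hl), act_apply]
  · rw [act_apply, restrictFix_of_notMem hl, restrictFix_of_notMem (mt (fixL_map_iff a).1 hl)]

theorem restrictFix_mem_inv (hf : f ∈ inv X k F) : restrictFix k F g f ∈ inv X k F :=
  fun a ha => by rw [act_restrictFix, hf a ha]

theorem smithDiff_restrictFix (hf : f ∈ inv X k F) :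
    smithDiff X k g (restrictFix k F g f) = 0 := by
  funext l
  rw [smithDiff_apply, act_restrictFix]
  by_cases hl : l ∈ fixL F g
  · rw [restrictFix_of_mem hl, restrictFix_of_mem hl, act_eq_of_mem_fixL hl hf, sub_self]; rfl
  · rw [restrictFix_of_notMem hl, restrictFix_of_notMem hl, sub_self]; rfl

theorem sub_restrictFix_mem_van (f : List X → k) : f - restrictFix k F g f ∈ van X k F g :=
  fun l hl => by rw [Pi.sub_apply, restrictFix_of_mem hl, sub_self]

theorem smithDiff_cobd (f : List X → k) :
    smithDiff X k g (cobd f) = cobd (smithDiff X k g f) := by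
  have := LinearMap.congr_fun (cobd_commute_act (k := k) (X := X) g) f
  simp only [Module.End.mul_apply] at this
  rw [smithDiff, LinearMap.sub_apply, LinearMap.sub_apply, map_sub, this]; rfl

theorem inv_sup_zpowers :
    inv X k (F ⊔ Subgroup.zpowers g) = inv X k F ⊓ LinearMap.ker (smithDiff X k g) := by
  ext f
  rw [Submodule.mem_inf, LinearMap.mem_ker, smithDiff, LinearMap.sub_apply, sub_eq_zero]
  constructor
  · exact fun h => ⟨fun a ha => h a ((le_sup_left : F ≤ _) ha),
      (h g ((le_sup_right : Subgroup.zpowers g ≤ _) (Subgroup.mem_zpowers g))).symm⟩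
  · rintro ⟨hF, hg⟩
    let S : Subgroup E :=
      { carrier := {a | act k a f = f}
        one_mem' := by simp [act_one]
        mul_mem' := fun {a b} (ha : _ = _) (hb : _ = _) => by
          rw [Set.mem_ofPred_eq, act_mul, Module.End.mul_apply, hb, ha]
        inv_mem' := fun {a} (ha : _ = _) => by
          rw [Set.mem_ofPred_eq]
          nth_rw 1 [← ha]
          rw [← Module.End.mul_apply, ← act_mul, inv_mul_cancel, act_one]; rfl }
    have : F ⊔ Subgroup.zpowers g ≤ S :=
      sup_le hF (Subgroup.zpowers_le.2 hg.symm)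
    exact fun a ha => this ha

variable [MetricSpace X] [IsIsometricSMul E X]

theorem SmithPair.map_locZero (hα : SmithPair X k p F g α β) :
    (locZero k (Set.univ : Set X) n).map α ≤ locZero k Set.univ n := by
  rintro _ ⟨f, hf, rfl⟩
  exact hα.stable _ (fun _ h => act_mem_locZero (fun _ _ => Set.mem_univ _) h) f hf

theorem mem_inf_cyc_sup {I : Submodule k (List X → k)}
    (h : f ∈ I ⊔ locZero k Set.univ n) (hf : cobd f ∈ locZero k Set.univ (n + 1)) :
    f ∈ (I ⊓ cyc k Set.univ n) ⊔ locZero k Set.univ n := by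
  obtain ⟨u, hu, z, hz, rfl⟩ := Submodule.mem_sup.1 h
  refine Submodule.add_mem_sup ⟨hu, ?_⟩ hz
  have := Submodule.sub_mem _ hf (cobd_mem_locZero hz)
  rwa [map_add, add_sub_cancel_right] at this

variable [CompactSpace X]

theorem SmithPair.cohRank (hα : SmithPair X k p F g α β) (hyp : SmithHyp E X p) {b c : ℕ}
    (hc : CohRank (smithSub X k F g α) (n + 1) c) (hb : CohRank (inv X k F) n b) :
    CohRank (smithSub X k F g β) n (c + b) := by
  obtain ⟨e, he, hsum⟩ := exists_orbit_weight hyp k F g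
  obtain ⟨s, hs, hsec⟩ := hα.exists_section e hsum
  have hinv : ∀ f ∈ inv X k F, s f ∈ inv X k F := hs _ (fun _ h => act_mem_inv h g)
    (fun _ h => mulFn_mem_inv he h)
  have hvan : ∀ f ∈ van X k F g, s f ∈ van X k F g := hs _ (fun _ h => van_act h g)
    (fun _ h => mulFn_mem_van e h)
  have hαs : ∀ f ∈ smithSub X k F g β, α (s f) = f := fun f hf => hsec f hf.1.2 hf.2
  have h1 : GenMod ((smithSub X k F g β ⊓ cyc k Set.univ n).map (cobd ∘ₗ s))
      ((smithSub X k F g α).map cobd ⊔ locZero k Set.univ (n + 1)) c := by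
    refine hc.sup.mono ?_ le_rfl le_rfl
    rintro _ ⟨φ, ⟨hφ, hφc⟩, rfl⟩
    refine mem_inf_cyc_sup (mem_smithSub_sup_of_map_mem hα (cobd_mem_inv (hinv _ hφ.1.1))
      (Submodule.mem_sup_left (cobd_mem_van (hvan _ hφ.1.2))) ?_) ?_
    · rw [LinearMap.comp_apply, ← hα.cobd_comm, hαs φ hφ]
      exact hφc
    · rw [LinearMap.comp_apply, cobd_cobd]
      exact Submodule.zero_mem _
  refine h1.comap.trans (GenMod.mono (hb.map α) ?_ ?_ le_rfl)
  · rintro φ ⟨hφ, hφs⟩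
    have := map_mem_map_of_cobd_mem (hinv _ hφ.1.1.1) hφs
    rwa [hαs φ hφ.1] at this
  · rw [Submodule.map_sup]
    exact sup_le_sup hα.map_inv_map_cobd hα.map_locZero

/-- Invariant cochains which restrict to cocycles on the fixed points. -/
def relCyc (k : Type*) [Field k] (F : Subgroup E) (g : E) (n : ℕ) : Submodule k (List X → k) :=
  inv X k F ⊓ (van X k F g ⊔ locZero k Set.univ (n + 1)).comap cobd

theorem genMod_relCyc (hyp : SmithHyp E X p) {b c : ℕ}
    (hc : CohRank (smithSub X k F g (smithDiff X k g)) (n + 1) c) (hb : CohRank (inv X k F) n b) :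
    GenMod (relCyc k F g n)
      ((inv X k F).map cobd ⊔ (van X k F g ⊔ locZero k (Set.univ : Set X) n)) (c + b) := by
  have hα := smithPair_diff_norm (X := X) (k := k) (F := F) (hyp.pow g)
  have h1 : GenMod ((relCyc k F g n).map (cobd ∘ₗ restrictFix k F g))
      ((smithSub X k F g (smithDiff X k g)).map cobd ⊔ locZero k (Set.univ : Set X) (n + 1)) c := by
    refine hc.sup.mono ?_ le_rfl le_rfl
    rintro _ ⟨f, ⟨hf, hfc⟩, rfl⟩
    refine mem_inf_cyc_sup (mem_smithSub_sup_of_map_mem hα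
      (cobd_mem_inv (restrictFix_mem_inv hf)) ?_ ?_) ?_
    · rw [LinearMap.comp_apply, ← sub_sub_cancel f (restrictFix k F g f), map_sub]
      exact Submodule.sub_mem _ hfc
        (Submodule.mem_sup_left (cobd_mem_van (sub_restrictFix_mem_van f)))
    · rw [LinearMap.comp_apply, smithDiff_cobd, smithDiff_restrictFix hf, map_zero]
      exact Submodule.zero_mem _
    · rw [LinearMap.comp_apply, cobd_cobd]
      exact Submodule.zero_mem _
  have hZ : locZero k (Set.univ : Set X) n ≤ van X k F g ⊔ locZero k Set.univ n := le_sup_right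
  have hV : van X k F g ≤
      (inv X k F).map cobd ⊔ (van X k F g ⊔ locZero k (Set.univ : Set X) n) :=
    le_sup_of_le_right le_sup_left
  have h2 : GenMod (inv X k F ⊓ cyc k Set.univ n)
      ((inv X k F).map cobd ⊔ (van X k F g ⊔ locZero k Set.univ n)) b :=
    GenMod.mono hb le_rfl (sup_le_sup_left hZ _) le_rfl
  have h2 := h2.sup_left hV
  refine h1.comap.trans (h2.mono ?_ le_rfl le_rfl)
  · rintro f ⟨⟨hf, -⟩, hfs⟩
    obtain ⟨_, ⟨ψ, hψ, rfl⟩, z, hz, e⟩ := Submodule.mem_sup.1 hfs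
    rw [← sub_add_cancel f (f - restrictFix k F g f + ψ)]
    refine Submodule.add_mem_sup ⟨?_, ?_⟩ (Submodule.add_mem _ (sub_restrictFix_mem_van f) hψ.1.2)
    · rw [sub_add_eq_sub_sub, sub_sub_cancel]
      exact Submodule.sub_mem _ (restrictFix_mem_inv hf) hψ.1.1
    · rw [sub_add_eq_sub_sub, sub_sub_cancel]
      change cobd (restrictFix k F g f - ψ) ∈ locZero k Set.univ (n + 1)
      rw [LinearMap.comp_apply] at e
      rw [map_sub, ← e, add_sub_cancel_left]
      exact hz

theorem cohRank_inv_sup (hyp : SmithHyp E X p) {b c h : ℕ}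
    (hh : CohRank (smithSub X k F g (smithDiff X k g)) n h)
    (hc : CohRank (smithSub X k F g (smithDiff X k g)) (n + 1) c) (hb : CohRank (inv X k F) n b) :
    CohRank (inv X k (F ⊔ Subgroup.zpowers g)) n (c + b + h) := by
  have hα := smithPair_diff_norm (X := X) (k := k) (F := F) (hyp.pow g)
  rw [CohRank, inv_sup_zpowers]
  set I := inv X k F ⊓ LinearMap.ker (smithDiff X k g) with hI
  have h1 := ((genMod_relCyc hyp hc hb).mono (A' := I ⊓ cyc k Set.univ n)
    (fun f hf => ⟨hf.1.1, Submodule.mem_sup_right hf.2⟩) le_rfl le_rfl).inf_left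
  refine h1.trans ?_
  have hle : (smithSub X k F g (smithDiff X k g)).map cobd ≤ I.map cobd :=
    Submodule.map_mono fun f hf => ⟨hf.1.1, hf.2⟩
  refine ((hh.mono le_rfl (sup_le_sup_right hle _) le_rfl).sup_left le_rfl).mono ?_ le_rfl le_rfl
  rintro f ⟨⟨⟨hf, hfd⟩, hfc⟩, hfs⟩
  obtain ⟨_, ⟨v, hv, rfl⟩, w, hw, e⟩ := Submodule.mem_sup.1 hfs
  have hv' : restrictFix k F g v ∈ I := ⟨restrictFix_mem_inv hv, smithDiff_restrictFix hv⟩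
  have key : f - cobd (restrictFix k F g v) ∈
      (smithSub X k F g (smithDiff X k g) ⊓ cyc k Set.univ n) ⊔ locZero k Set.univ n := by
    refine mem_inf_cyc_sup (mem_smithSub_sup_of_map_mem hα
      (Submodule.sub_mem _ hf (cobd_mem_inv hv'.1)) ?_ ?_) ?_
    · rw [← e, add_sub_right_comm, ← map_sub]
      exact Submodule.add_mem _
        (Submodule.mem_sup_left (cobd_mem_van (sub_restrictFix_mem_van v))) hw
    · rw [map_sub, LinearMap.mem_ker.1 hfd, smithDiff_cobd, smithDiff_restrictFix hv, map_zero,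
        sub_zero]
      exact Submodule.zero_mem _
    · rw [map_sub, cobd_cobd, sub_zero]
      exact hfc
  rw [← sub_add_cancel f (cobd (restrictFix k F g v))]
  have hle' := sup_le_sup_left (le_sup_right : locZero k (Set.univ : Set X) n ≤ I.map cobd ⊔ _)
    (smithSub X k F g (smithDiff X k g) ⊓ cyc k Set.univ n)
  exact Submodule.add_mem _ (hle' key)
    (Submodule.mem_sup_right (Submodule.mem_sup_left ⟨_, hv', rfl⟩))

end Sequences

open Filter Topology

section Weight

variable {X : Type*} [TopologicalSpace X] {k : Type*} [Field k]

theorem mulFn_mem_cyc {U : Set X} {n : ℕ} (hn : n ≠ 0) {w : List X → k}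
    (hw : ∀ x ∈ U, ∃ N ∈ 𝓝 x, ∃ c, ∀ l : List X, l ≠ [] → (∀ y ∈ l, y ∈ N) → w l = c)
    {f : List X → k} (hf : f ∈ cyc k U n) : mulFn w f ∈ cyc k U n := by
  refine ⟨by simp, fun x hx => ?_⟩
  obtain ⟨N, hN, c, hc⟩ := hw x hx
  obtain ⟨N', hN', h⟩ := (mem_cyc.1 hf).2 x hx
  refine ⟨N ∩ N', inter_mem hN hN', fun l hl hlN => ?_⟩
  have h0 : cobd (mulFn w f - c • f) l = 0 := by
    refine cobd_eq_zero fun l' hl' hs => ?_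
    have : l' ≠ [] := by rintro rfl; simp at hl'; omega
    rw [Pi.sub_apply, mulFn_apply, hc l' this fun y hy => (hlN y (hs hy)).1, Pi.smul_apply,
      smul_eq_mul, sub_self]
  rw [map_sub, map_smul, Pi.sub_apply, Pi.smul_apply, h l hl fun y hy => (hlN y hy).2,
    smul_zero, sub_zero] at h0
  exact h0

end Weight

theorem exists_separated_orbit {X E : Type*} [MetricSpace X] [SMul E X] [Finite E] (y : X) :
    ∃ r > 0, ∀ c d : E, dist (c • y) (d • y) < r → c • y = d • y := by
  have h : ∀ c d : E, ∀ᶠ r in 𝓝[>] (0 : ℝ), dist (c • y) (d • y) < r → c • y = d • y := by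
    intro c d
    by_cases hcd : c • y = d • y
    · exact Eventually.of_forall fun _ _ => hcd
    · filter_upwards [Ioo_mem_nhdsGT (dist_pos.2 hcd)] with r hr h
      exact absurd h (not_lt.2 hr.2.le)
  have h' : ∀ᶠ r in 𝓝[>] (0 : ℝ), ∀ c d : E, dist (c • y) (d • y) < r → c • y = d • y :=
    eventually_all.2 fun c => eventually_all.2 fun d => h c d
  obtain ⟨r, h1, h2⟩ := (h'.and self_mem_nhdsWithin).exists
  exact ⟨r, h2, h1⟩

section Good

variable {X E : Type*} [CommGroup E] [MulAction E X] {k : Type*} [Field k] {p : ℕ}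
  {F : Subgroup E} {g : E} [MetricSpace X] [CompactSpace X] [IsIsometricSMul E X]

/-- The cocycles vanishing near `O` are coboundaries in degrees above `D`. -/
def VanishRel (k : Type*) [Field k] (p : ℕ) (F : Subgroup E) (g : E) (D : ℕ) (O : Set X) : Prop :=
  ∀ n > D, ∀ α β : Module.End k (List X → k), SmithPair X k p F g α β →
    SmithPair X k p F g β α → smithSub X k F g β ⊓ cyc k Set.univ n ⊓ locZero k O n ≤
      (smithSub X k F g β).map cobd ⊔ locZero k Set.univ n

theorem VanishRel.of_union {D : ℕ} (hD : ∀ n > D, CohRank (inv X k F) n 0) {O U : Set X}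
    (hO : ∀ x ∈ O, g • x ∈ O) (hU : ∀ x ∈ U, g • x ∈ U) {e : List X → k} (he : e ∈ inv X k F)
    (hsum : ∀ l ∉ fixL F g, ∑ i ∈ Finset.range p, e (l.map (g ^ i • ·)) = 1)
    (hloc : ∀ x ∈ U, ∃ N ∈ 𝓝 x, ∃ c, ∀ l : List X, l ≠ [] → (∀ y ∈ l, y ∈ N) → e l = c)
    (h : VanishRel k p F g D (O ∪ U)) : VanishRel k p F g D O := by
  rintro n hn α β hα hβ φ ⟨⟨hφ, hφc⟩, hφO⟩
  obtain ⟨s, hs, hsec⟩ := hα.exists_section e hsum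
  have hinv : s φ ∈ inv X k F := hs _ (fun _ h => act_mem_inv h g)
    (fun _ h => mulFn_mem_inv he h) _ hφ.1.1
  have hvan : s φ ∈ van X k F g := hs _ (fun _ h => van_act h g)
    (fun _ h => mulFn_mem_van e h) _ hφ.1.2
  have hsO : s φ ∈ locZero k O n := hs _ (fun _ h => act_mem_locZero hO h)
    (fun _ h => mulFn_mem_locZero e h) _ hφO
  have hsU : s φ ∈ cyc k U n := by
    refine hs _ (fun f hf => ?_) (fun _ h => mulFn_mem_cyc (by omega) hloc h) _
      (cyc_anti (Set.subset_univ U) hφc)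
    have := LinearMap.congr_fun (cobd_commute_act (k := k) (X := X) g) f
    simp only [Module.End.mul_apply] at this
    rw [mem_cyc, this]
    exact act_mem_locZero hU hf
  have hαs : α (s φ) = φ := hsec φ hφ.1.2 hφ.2
  have hcO : cobd (s φ) ∈ locZero k (O ∪ U) (n + 1) :=
    mem_locZero_union (cobd_mem_locZero hsO) hsU
  have h1 : cobd (s φ) ∈ (smithSub X k F g α ⊓ cyc k Set.univ (n + 1)) ⊔
      locZero k Set.univ (n + 1) := by
    refine mem_inf_cyc_sup (mem_smithSub_sup_of_map_mem hα (cobd_mem_inv hinv)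
      (Submodule.mem_sup_left (cobd_mem_van hvan)) ?_) ?_
    · rw [← hα.cobd_comm, hαs]
      exact hφc
    · rw [cobd_cobd]
      exact Submodule.zero_mem _
  have h2 : cobd (s φ) ∈ (smithSub X k F g α).map cobd ⊔ locZero k Set.univ (n + 1) := by
    obtain ⟨u, hu, z, hz, e⟩ := Submodule.mem_sup.1 h1
    rw [← e]
    refine Submodule.add_mem _ (h (n + 1) (by omega) β α hβ hα ⟨hu, ?_⟩)
      (Submodule.mem_sup_right hz)
    rw [← add_sub_cancel_right u z, e]
    exact Submodule.sub_mem _ hcO (locZero_anti (Set.subset_univ _) hz)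
  have h3 := map_mem_map_of_cobd_mem hinv h2
  rw [hαs] at h3
  have h4 := Submodule.map_mono (f := α) (genMod_zero_iff.1 (hD n hn)) h3
  rw [Submodule.map_sup] at h4
  exact sup_le_sup hα.map_inv_map_cobd hα.map_locZero h4

open Classical in
theorem exists_local_weight [Finite E] (hyp : SmithHyp E X p) (k : Type*) [Field k] {y : X}
    (hy : [y] ∉ fixL F g) :
    ∃ U : Set X, IsOpen U ∧ y ∈ U ∧ (∀ x ∈ U, g • x ∈ U) ∧ ∃ e ∈ inv X k F,
      (∀ l ∉ fixL F g, ∑ i ∈ Finset.range p, e (l.map (g ^ i • ·)) = 1) ∧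
      ∀ x ∈ U, ∃ N ∈ 𝓝 x, ∃ c, ∀ l : List X, l ≠ [] → (∀ y ∈ l, y ∈ N) → e l = c := by
  obtain ⟨r, hr, hsep⟩ := exists_separated_orbit (E := E) y
  obtain ⟨e₀, he₀, hsum₀⟩ := exists_orbit_weight hyp k F g
  set U' : Set X := {x | ∃ a ∈ F, dist x (a • y) < r / 2} with hU'
  have hU'o : IsOpen U' := by
    have : U' = ⋃ a ∈ F, Metric.ball (a • y) (r / 2) := by
      ext x; simp [hU']
    rw [this]
    exact isOpen_biUnion fun _ _ => Metric.isOpen_ball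
  have hU'F : ∀ a ∈ F, ∀ x, a • x ∈ U' ↔ x ∈ U' := by
    intro a ha x
    constructor
    · rintro ⟨b, hb, h⟩
      refine ⟨a⁻¹ * b, F.mul_mem (F.inv_mem ha) hb, ?_⟩
      rwa [mul_smul, ← dist_smul a, smul_inv_smul]
    · rintro ⟨b, hb, h⟩
      refine ⟨a * b, F.mul_mem ha hb, ?_⟩
      rwa [mul_smul, dist_smul]
  have huniq : ∀ x, ∀ i < p, ∀ j < p, g ^ i • x ∈ U' → g ^ j • x ∈ U' → i = j := by
    rintro x i hi j hj ⟨a, ha, h1⟩ ⟨b, hb, h2⟩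
    by_contra hij
    rw [← dist_smul (g ^ j), smul_smul] at h1
    rw [← dist_smul (g ^ i), smul_smul, ← pow_add, add_comm, pow_add] at h2
    have h3 := hsep (g ^ j * a) (g ^ i * b) (by
      rw [mul_smul, mul_smul]
      have := dist_triangle_left (g ^ j • a • y) (g ^ i • b • y) ((g ^ j * g ^ i) • x)
      linarith)
    refine hy (mem_fixL_of_zpow hyp (m := (i : ℤ) - j) ?_ (F.mul_mem hb (F.inv_mem ha)) ?_)
    · intro hd
      have := Int.eq_zero_of_abs_lt_dvd hd (abs_sub_lt_iff.2 ⟨by omega, by omega⟩)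
      omega
    · intro x hx
      rw [List.mem_singleton] at hx
      subst hx
      have e : g ^ ((i : ℤ) - j) * (b * a⁻¹) = (g ^ j * a)⁻¹ * (g ^ i * b) := by
        rw [zpow_sub, zpow_natCast, zpow_natCast, mul_inv]
        simp only [mul_comm, mul_left_comm, mul_assoc]
      rw [e, mul_smul, ← h3, inv_smul_smul]
  set U : Set X := {x | ∃ i < p, g ^ i • x ∈ U'} with hU
  have hpow : ∀ i : ℕ, ∀ x, g ^ i • x ∈ U ↔ x ∈ U := by
    have hg : ∀ x ∈ U, g • x ∈ U := by
      rintro x ⟨i, hi, h⟩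
      rcases i with _ | i
      · refine ⟨p - 1, by omega, ?_⟩
        rw [smul_smul, ← pow_succ, Nat.sub_add_cancel (by omega), hyp.pow]
        simpa using h
      · refine ⟨i, by omega, ?_⟩
        rwa [smul_smul, ← pow_succ]
    have hgi : ∀ i : ℕ, ∀ x ∈ U, g ^ i • x ∈ U := by
      intro i
      induction i with
      | zero => simp
      | succ i ih => exact fun x hx => by rw [pow_succ', mul_smul]; exact hg _ (ih x hx)
    refine fun i x => ⟨fun h => ?_, hgi i x⟩
    have h' := hgi ((p - 1) * i) _ h
    rw [smul_smul, ← pow_add] at h'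
    have : (p - 1) * i + i = p * i := by
      obtain ⟨q, rfl⟩ := Nat.exists_eq_add_of_lt hyp.prime.pos
      simp; ring
    rw [this, pow_mul, hyp.pow, one_pow, one_smul] at h'
    exact h'
  have hUF : ∀ a ∈ F, ∀ x, a • x ∈ U ↔ x ∈ U := fun a ha x => by
    simp only [hU, Set.mem_ofPred_eq, smul_comm _ a, hU'F a ha]
  have hV : ∀ i : ℕ, IsOpen {x | g ^ i • x ∈ U'} := fun i =>
    hU'o.preimage (continuous_const_smul (g ^ i))
  have hUo : IsOpen U := by
    have : U = ⋃ i, ⋃ _ : i < p, {x | g ^ i • x ∈ U'} := by ext x; simp [hU]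
    rw [this]
    exact isOpen_iUnion fun i => isOpen_iUnion fun _ => hV i
  have hyU : y ∈ U := ⟨0, hyp.prime.pos, 1, F.one_mem, by simpa using hr⟩
  set e : List X → k := fun l => if ∃ x ∈ l.head?, x ∈ U then
    (if ∃ x ∈ l.head?, x ∈ U' then 1 else 0) else e₀ l with he
  refine ⟨U, hUo, hyU, fun x hx => by simpa using (hpow 1 x).2 hx, e, ?_, ?_, ?_⟩
  · intro a ha
    funext l
    have h0 := congrFun (he₀ a ha) l
    rw [act_apply] at h0
    cases l with
    | nil => simp [he, act_apply]
    | cons x l =>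
      rw [act_apply]
      simp only [he, h0]
      simp [hUF a ha, hU'F a ha]
  · intro l hl
    cases l with
    | nil => exact absurd nil_mem_fixL hl
    | cons x l =>
      by_cases hx : x ∈ U
      · have h1 : ∀ i, e ((x :: l).map (g ^ i • ·)) = if g ^ i • x ∈ U' then 1 else 0 := by
          intro i
          simp [he, hpow, hx]
        simp only [h1]
        obtain ⟨i, hi, hxi⟩ := hx
        rw [Finset.sum_eq_single_of_mem i (Finset.mem_range.2 hi), if_pos hxi]
        exact fun j hj hji => if_neg fun h => hji (huniq x j (Finset.mem_range.1 hj) i hi h hxi)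
      · rw [← hsum₀ _ hl]
        refine Finset.sum_congr rfl fun i _ => ?_
        simp [he, hpow, hx]
  · intro x hx
    have hx' := hx
    obtain ⟨i, hi, hxi⟩ := hx
    refine ⟨U ∩ {x | g ^ i • x ∈ U'}, inter_mem (hUo.mem_nhds hx') ((hV i).mem_nhds hxi),
      if i = 0 then 1 else 0, fun l hl hlN => ?_⟩
    cases l with
    | nil => exact absurd rfl hl
    | cons z l =>
      obtain ⟨hz, hzi⟩ := hlN z (by simp)
      have : z ∈ U' ↔ i = 0 := by
        constructor
        · intro hz'
          exact huniq z i hi 0 hyp.prime.pos hzi (by simpa using hz')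
        · rintro rfl
          simpa using hzi
      simp [he, hz, this]

theorem VanishRel.of_forall_singleton_mem [Finite E] (hyp : SmithHyp E X p) {D : ℕ}
    (hD : ∀ n > D, CohRank (inv X k F) n 0) {O : Set X} (hOo : IsOpen O)
    (hO : ∀ x ∈ O, g • x ∈ O) (hT : ∀ x, [x] ∈ fixL F g → x ∈ O) :
    VanishRel k p F g D O := by
  have hstep : ∀ y : X, ∃ U : Set X, IsOpen U ∧ (y ∉ O → y ∈ U) ∧ (∀ x ∈ U, g • x ∈ U) ∧
      ∀ O : Set X, (∀ x ∈ O, g • x ∈ O) → VanishRel k p F g D (O ∪ U) →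
        VanishRel k p F g D O := by
    intro y
    by_cases hy : y ∈ O
    · exact ⟨∅, isOpen_empty, fun h => absurd hy h, by simp, fun O _ h => by simpa using h⟩
    · obtain ⟨U, hU, hyU, hgU, e, he, hsum, hloc⟩ :=
        exists_local_weight hyp k (mt (hT y) hy)
      exact ⟨U, hU, fun _ => hyU, hgU, fun O hO h => h.of_union hD hO hgU he hsum hloc⟩
  choose U hUo hyU hgU hU using hstep
  have hfin : ∀ (t : Finset X) (O : Set X), (∀ x ∈ O, g • x ∈ O) →
      VanishRel k p F g D (O ∪ ⋃ y ∈ t, U y) → VanishRel k p F g D O := by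
    classical
    intro t
    induction t using Finset.induction_on with
    | empty => intro O _ h; simpa using h
    | insert y t _ ih =>
      intro O hO h
      refine hU y O hO (ih _ (fun x hx => hx.imp (hO x) (hgU y x)) ?_)
      rwa [Finset.set_biUnion_insert, ← Set.union_assoc] at h
  obtain ⟨t, ht⟩ := hOo.isClosed_compl.isCompact.elim_finite_subcover U hUo
    fun y hy => Set.mem_iUnion.2 ⟨y, hyU y hy⟩
  refine hfin t O hO ?_
  have : O ∪ ⋃ y ∈ t, U y = Set.univ := by
    rw [Set.eq_univ_iff_forall]
    exact fun x => (em (x ∈ O)).imp id fun h => ht h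
  rw [this]
  exact fun n _ α β _ _ φ hφ => Submodule.mem_sup_right hφ.2

end Good

open Filter Topology

theorem exists_equivariant_of_forall_exists {E X : Type*} [Group E] [MulAction E X]
    {P : X → X → Prop} (hP : ∀ (a : E) x y, P x y → P (a • x) (a • y))
    (h : ∀ x, ∃ y, P x y ∧ ∀ b : E, b • x = x → b • y = y) :
    ∃ φ : X → X, (∀ x, P x (φ x)) ∧ ∀ (a : E) x, φ (a • x) = a • φ x := by
  choose ψ hψ hb using h
  let R := MulAction.orbitRel E X
  have hrep : ∀ x : X, ∃ c : E, c • (Quotient.mk R x).out = x := fun x =>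
    R.symm (Quotient.exact (Quotient.out_eq (Quotient.mk R x)))
  choose c hc using hrep
  refine ⟨fun x => c x • ψ (Quotient.mk R x).out, fun x => ?_, fun a x => ?_⟩
  · have := hP (c x) _ _ (hψ (Quotient.mk R x).out)
    rwa [hc x] at this
  · have e : Quotient.mk R (a • x) = Quotient.mk R x := Quotient.sound (s := R) ⟨a, rfl⟩
    have h1 := hc (a • x)
    rw [e] at h1
    have h2 := hb (Quotient.mk R x).out ((a * c x)⁻¹ * c (a • x)) (by
      rw [mul_smul, h1, mul_inv_rev, mul_smul, inv_smul_smul, inv_smul_eq_iff, hc x])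
    rw [mul_smul, inv_smul_eq_iff, mul_smul] at h2
    simp only [e, h2]

section Taut

variable {X E : Type*} [CommGroup E] [MulAction E X] {k : Type*} [Field k] {p : ℕ}
  {F : Subgroup E} {g : E}

theorem ne_one_of_mul (hg : g ∉ F) {a : E} (ha : a ∈ F) : g * a ≠ 1 := fun h =>
  hg (by rw [eq_inv_of_mul_eq_one_left h]; exact F.inv_mem ha)

theorem SmithHyp.smul_eq (hyp : SmithHyp E X p) {a b : E} (ha : a ≠ 1) {x y : X} (hax : a • x = x)
    (hbx : b • x = x) (hay : a • y = y) : b • y = y := by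
  have : a ∈ MulAction.stabilizer E y := hay
  exact Subgroup.zpowers_le.2 this (hyp.stab a b x ha hax hbx)

variable [MetricSpace X] [CompactSpace X] [IsIsometricSMul E X]

theorem SmithHyp.eventually_smul_eq [Finite E] (hyp : SmithHyp E X p) :
    ∀ᶠ r in 𝓝[>] (0 : ℝ), ∀ a b : E, a ≠ 1 → b ≠ 1 → ∀ x y : X, a • x = x → b • y = y →
      dist x y < r → b • x = x := by
  refine eventually_all.2 fun a => eventually_all.2 fun b => ?_
  rw [eventually_imp_distrib_left]
  intro ha
  rw [eventually_imp_distrib_left]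
  intro hb
  by_cases h : ∃ z : X, a • z = z ∧ b • z = z
  · obtain ⟨z, hz, hz'⟩ := h
    exact Eventually.of_forall fun r x y hx _ _ => hyp.smul_eq ha hz hz' hx
  · have hcl : ∀ c : E, IsClosed {x : X | c • x = x} := fun c =>
      isClosed_eq (continuous_const_smul c) continuous_id
    have hd : Disjoint {x : X | a • x = x} {x | b • x = x} :=
      Set.disjoint_left.2 fun z hz hz' => h ⟨z, hz, hz'⟩
    obtain ⟨δ, hδ, hdis⟩ := hd.exists_thickenings (hcl a).isCompact (hcl b)
    filter_upwards [Ioo_mem_nhdsGT hδ] with r hr x y hx hy hxy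
    refine absurd (Metric.self_subset_thickening hδ {x | b • x = x} hy)
      (Set.disjoint_left.1 hdis (Metric.mem_thickening_iff.2 ⟨x, hx, ?_⟩))
    rw [dist_comm]
    exact hxy.trans hr.2

theorem cohRank_smithSub_zero [Finite E] (hyp : SmithHyp E X p) (hg : g ∉ F) {D : ℕ}
    (hD : ∀ n > D, CohRank (inv X k F) n 0) {α β : Module.End k (List X → k)}
    (hα : SmithPair X k p F g α β) (hβ : SmithPair X k p F g β α) {n : ℕ} (hn : D < n) :
    CohRank (smithSub X k F g β) n 0 := by
  refine genMod_zero_iff.2 ?_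
  rintro φ ⟨hφ, hφc⟩
  obtain ⟨δ, hδ, hzero⟩ := exists_small_of_mem_locZero_univ (mem_cyc.1 hφc)
  obtain ⟨r, hsep, hr : 0 < r⟩ :=
    ((hyp.eventually_smul_eq (X := X)).and self_mem_nhdsWithin).exists
  set ε := min δ r / 3 with hε
  have hε0 : 0 < ε := by positivity
  have hεδ : 3 * ε ≤ δ := by rw [hε]; linarith [min_le_left δ r]
  have hεr : 3 * ε ≤ r := by rw [hε]; linarith [min_le_right δ r]
  set T : Set X := {x | [x] ∈ fixL F g} with hT
  have hTa : ∀ (a : E), ∀ x ∈ T, a • x ∈ T := fun a x hx => fixL_map (l := [x]) hx a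
  set N := Metric.thickening ε T with hN
  have hNa : ∀ (a : E), ∀ x ∈ N, a • x ∈ N := by
    intro a x hx
    obtain ⟨y, hy, hxy⟩ := Metric.mem_thickening_iff.1 hx
    exact Metric.mem_thickening_iff.2 ⟨a • y, hTa a y hy, by rwa [dist_smul]⟩
  have hgood : VanishRel k p F g D N := VanishRel.of_forall_singleton_mem hyp hD
    Metric.isOpen_thickening (hNa g) fun x hx => Metric.self_subset_thickening hε0 _ hx
  obtain ⟨h, hh, hequiv⟩ := exists_equivariant_of_forall_exists (E := E)
      (P := fun x y => dist x y < ε ∧ (x ∈ N → y ∈ T)) (fun a x y hxy => by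
    refine ⟨by rw [dist_smul]; exact hxy.1, fun hx => hTa a y (hxy.2 ?_)⟩
    simpa using hNa a⁻¹ _ hx) (fun x => by
    by_cases hx : x ∈ N
    · obtain ⟨y, hy, hxy⟩ := Metric.mem_thickening_iff.1 hx
      refine ⟨y, ⟨hxy, fun _ => hy⟩, fun b hb => ?_⟩
      by_cases hb1 : b = 1
      · rw [hb1, one_smul]
      obtain ⟨a, ha, hay⟩ := hy
      have hay := hay y (by simp)
      have := hsep b (g * a) hb1 (ne_one_of_mul hg ha) x y hb hay (by linarith)
      exact hyp.smul_eq (ne_one_of_mul hg ha) this hb hay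
    · exact ⟨x, ⟨by simpa using hε0, fun h => absurd h hx⟩, fun b hb => hb⟩)
  have hdist : ∀ x y, dist x y < ε → dist (h x) (h y) < 3 * ε ∧ dist x (h y) < 3 * ε := by
    intro x y hxy
    have h1 := (hh x).1
    have h2 := (hh y).1
    have h3 := dist_triangle4 (h x) x y (h y)
    have h4 := dist_triangle x y (h y)
    rw [dist_comm (h x) x] at h3
    constructor <;> linarith
  have hmapfix : ∀ (c : E) (l : List X), (∀ x ∈ l, c • x = x) → ∀ x ∈ l.map h, c • x = x := by
    intro c l hl x hx
    obtain ⟨y, hy, rfl⟩ := List.mem_map.1 hx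
    rw [← hequiv, hl y hy]
  have hsmall : ∀ l : List X, Small ε l → Small (3 * ε) (l ++ l.map h) := by
    intro l hl x hx y hy
    simp only [List.mem_append, List.mem_map] at hx hy
    rcases hx with hx | ⟨x, hx, rfl⟩ <;> rcases hy with hy | ⟨y, hy, rfl⟩
    · linarith [hl x hx y hy]
    · exact (hdist x y (hl x hx y hy)).2
    · rw [dist_comm]
      exact (hdist y x (hl y hy x hx)).2
    · exact (hdist x y (hl x hx y hy)).1
  have hmem : ∀ ψ : Module.End k (List X → k), (∀ a : E, Commute ψ (act k a)) →
      (∀ f ∈ van X k F g, ψ f ∈ van X k F g) → ψ φ ∈ smithSub X k F g β := by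
    refine fun ψ h1 h2 => ⟨⟨inv_of_commute h1 hφ.1.1, h2 φ hφ.1.2⟩, ?_⟩
    have := LinearMap.congr_fun (hβ.comm ψ (h1 g)) φ
    simp only [Module.End.mul_apply, LinearMap.mem_ker.1 hφ.2, map_zero] at this
    exact this.symm
  have hprism : prism id h φ ∈ smithSub X k F g β := by
    refine hmem _ (prism_commute_act hequiv) fun f hf l ⟨a, ha, hl⟩ => prism_eq_zero
      fun l' _ hs => hf l' ⟨a, ha, fun x hx => ?_⟩
    have := hs hx
    rw [List.map_id, List.mem_append] at this
    exact this.elim (hl x) (hmapfix _ l hl x)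
  have hpull : pull h φ ∈ smithSub X k F g β :=
    hmem _ (pull_commute_act hequiv) fun f hf l ⟨a, ha, hl⟩ => hf _ ⟨a, ha, hmapfix _ l hl⟩
  have hpc : pull h φ ∈ cyc k Set.univ n := by
    refine mem_cyc.2 (mem_locZero_univ_of_small hε0 fun l hl hs => ?_)
    rw [cobd_pull, pull_apply]
    exact hzero _ (by simpa using hl)
      ((hsmall l hs).mono (List.subset_append_right _ _) hεδ)
  have hpN : pull h φ ∈ locZero k N n := by
    refine ⟨by omega, fun x hx => ⟨N ∩ Metric.ball x (ε / 2),
      inter_mem (Metric.isOpen_thickening.mem_nhds hx) (Metric.ball_mem_nhds x (by positivity)),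
      fun l hl hlN => ?_⟩⟩
    have hs : Small ε l := by
      intro y hy z hz
      have h1 := Metric.mem_ball.1 (hlN y hy).2
      have h2 := Metric.mem_ball.1 (hlN z hz).2
      have := dist_triangle_right y z x
      linarith
    refine hφ.1.2 _ ?_
    cases l with
    | nil => exact nil_mem_fixL
    | cons y l =>
      obtain ⟨a, ha, hy⟩ := (hh y).2 (hlN y (by simp)).1
      refine ⟨a, ha, fun w hw => ?_⟩
      obtain ⟨z, hz, rfl⟩ := List.mem_map.1 hw
      obtain ⟨b, hb, hbz⟩ := (hh z).2 (hlN z hz).1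
      exact hsep _ _ (ne_one_of_mul hg hb) (ne_one_of_mul hg ha) (h z) (h y)
        (hbz _ (by simp)) (hy _ (by simp))
        ((hdist z y (hs z hz y (by simp))).1.trans_le hεr)
  have key := hgood n hn α β hα hβ ⟨⟨hpull, hpc⟩, hpN⟩
  have hcp := cobd_prism id h φ
  have hid : pull id φ = φ := by funext l; simp
  have e : φ = pull h φ - cobd (prism id h φ) - prism id h (cobd φ) := by
    rw [sub_sub, hcp, hid, sub_sub_cancel]
  rw [e]
  refine Submodule.sub_mem _ (Submodule.sub_mem _ key
    (Submodule.mem_sup_left ⟨_, hprism, rfl⟩)) (Submodule.mem_sup_right ?_)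
  refine mem_locZero_univ_of_small hε0 fun l hl hs => prism_eq_zero fun l' hl' hsub => ?_
  rw [List.map_id] at hsub
  exact hzero l' (by omega) ((hsmall l hs).mono hsub hεδ)

end Taut

theorem SmithHyp.stabilizer_eq {X E : Type*} [CommGroup E] [MulAction E X] {p : ℕ}
    (hyp : SmithHyp E X p) {a : E} (ha : a ≠ 1) {x : X} (hx : a • x = x) :
    MulAction.stabilizer E x = Subgroup.zpowers a :=
  le_antisymm (fun b hb => hyp.stab a b x ha hx hb) (Subgroup.zpowers_le.2 hx)

section Count

variable {X E : Type*} [CommGroup E] [MulAction E X] {k : Type*} [Field k] {p : ℕ}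
  {F : Subgroup E} {g : E} {B D : ℕ}

open Classical in
/-- The indicator of the one-element lists fixed by `H`. -/
noncomputable def fixInd (k : Type*) [Field k] (H : Subgroup E) : List X → k := fun l =>
  if l.length = 1 ∧ ∀ x ∈ l, H ≤ MulAction.stabilizer E x then 1 else 0

open Classical in
theorem fixInd_singleton (H : Subgroup E) (x : X) :
    fixInd k H [x] = if H ≤ MulAction.stabilizer E x then 1 else 0 :=
  if_congr (by simp) rfl rfl

variable [MetricSpace X]

/-- The invariant cohomology has dimension at most `B` in every degree and vanishes in degrees
above `D`. -/
def BettiBound (X k : Type*) {E : Type*} [CommGroup E] [Field k] [MetricSpace X] [MulAction E X]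
    (F : Subgroup E) (B D : ℕ) : Prop :=
  (∀ n, CohRank (inv X k F) n B) ∧ ∀ n > D, CohRank (inv X k F) n 0

theorem BettiBound.mono (h : BettiBound X k F B D) {B' : ℕ} (hB : B ≤ B') :
    BettiBound X k F B' D :=
  ⟨fun n => GenMod.mono (h.1 n) le_rfl le_rfl hB, h.2⟩

theorem bettiBound_bot {B D : ℕ} (h : ∀ n, GenMod (cyc k (Set.univ : Set X) n)
    (bdry k Set.univ n) B ∧ (D < n → cyc k (Set.univ : Set X) n ≤ bdry k Set.univ n)) :
    BettiBound X k (⊥ : Subgroup E) B D := by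
  have e : inv X k (⊥ : Subgroup E) = ⊤ := by
    refine eq_top_iff.2 fun f _ a ha => ?_
    rw [Subgroup.mem_bot.1 ha, act_one]; rfl
  have e' : (⊤ : Submodule k (List X → k)).map cobd = LinearMap.range cobd := Submodule.map_top _
  refine ⟨fun n => ?_, fun n hn => ?_⟩ <;> rw [CohRank, e, e', top_inf_eq]
  · exact (h n).1
  · exact genMod_zero_iff.2 ((h n).2 hn)

variable [CompactSpace X] [IsIsometricSMul E X] [Finite E]

theorem BettiBound.cohRank_smithSub (h : BettiBound X k F B D) (hyp : SmithHyp E X p) (hg : g ∉ F)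
    {α β : Module.End k (List X → k)} (hα : SmithPair X k p F g α β)
    (hβ : SmithPair X k p F g β α) {n : ℕ} : CohRank (smithSub X k F g β) n ((D + 1) * B) := by
  have key : ∀ j n : ℕ, D < n + j → ∀ α β : Module.End k (List X → k), SmithPair X k p F g α β →
      SmithPair X k p F g β α → CohRank (smithSub X k F g β) n (j * B) := by
    intro j
    induction j with
    | zero =>
      intro n hn α β hα hβ
      rw [zero_mul]
      exact cohRank_smithSub_zero hyp hg h.2 hα hβ hn
    | succ j ih =>
      intro n hn α β hα hβ
      rw [add_one_mul]
      exact hα.cohRank hyp (ih (n + 1) (by omega) β α hβ hα) (h.1 n)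
  exact key (D + 1) n (by omega) α β hα hβ

theorem BettiBound.sup_zpowers (h : BettiBound X k F B D) (hyp : SmithHyp E X p) (hp : (p : k) = 0)
    (hg : g ∉ F) : BettiBound X k (F ⊔ Subgroup.zpowers g) ((2 * D + 3) * B) D := by
  have h1 := smithPair_norm_diff (X := X) (F := F) (hyp.pow g) hp
  have h2 := smithPair_diff_norm (X := X) (k := k) (F := F) (hyp.pow g)
  refine ⟨fun n => ?_, fun n hn => ?_⟩
  · have := cohRank_inv_sup hyp (h.cohRank_smithSub hyp hg h1 h2)
      (h.cohRank_smithSub hyp hg h1 h2) (h.1 n)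
    rwa [show (D + 1) * B + B + (D + 1) * B = (2 * D + 3) * B by ring] at this
  · exact cohRank_inv_sup hyp (cohRank_smithSub_zero hyp hg h.2 h1 h2 hn)
      (cohRank_smithSub_zero hyp hg h.2 h1 h2 (by omega)) (h.2 n hn)

theorem fixInd_mem_relCyc (hyp : SmithHyp E X p) (hg : g ∉ F) (H : Subgroup E) :
    fixInd (X := X) k H ∈ relCyc k F g 1 := by
  classical
  refine ⟨fun a _ => ?_, Submodule.mem_sup_left fun l ⟨a, ha, hl⟩ => ?_⟩
  · funext l
    rw [act_apply]
    refine if_congr ?_ rfl rfl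
    simp
  · by_cases hl2 : l.length = 2
    · obtain ⟨x, y, rfl⟩ := List.length_eq_two.1 hl2
      have hx := hyp.stabilizer_eq (ne_one_of_mul hg ha) (hl x (by simp))
      have hy := hyp.stabilizer_eq (ne_one_of_mul hg ha) (hl y (by simp))
      simp only [cobd_cons, cobd_nil, fixInd_singleton, sub_zero]
      rw [sub_eq_zero]
      exact if_congr (by rw [hx, hy]) rfl rfl
    · refine cobd_eq_zero fun l' hl' _ => if_neg ?_
      rintro ⟨h, -⟩
      omega

theorem ncard_stabilizer_le (h : BettiBound X k F B D) (hyp : SmithHyp E X p) (hp : (p : k) = 0)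
    (hg : g ∉ F) :
    {H : Subgroup E | ∃ x : X, H = MulAction.stabilizer E x ∧ ∃ a ∈ F, g * a ∈ H}.ncard ≤
      (D + 2) * B + 1 := by
  classical
  set S := {H : Subgroup E | ∃ x : X, H = MulAction.stabilizer E x ∧ ∃ a ∈ F, g * a ∈ H} with hS
  have : Fintype S := Fintype.ofFinite S
  have hx : ∀ H : S, ∃ x : X, H.1 = MulAction.stabilizer E x ∧ ∃ a ∈ F, g * a ∈ H.1 := fun H => H.2
  choose x hx a ha hax using hx
  have hfix : ∀ H, [x H] ∈ fixL F g := fun H =>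
    ⟨a H, ha H, by have := hax H; rw [hx] at this; simpa using this⟩
  let ev : (List X → k) →ₗ[k] (S → k) := LinearMap.pi fun H => LinearMap.proj [x H]
  have hev : ∀ f H, ev f H = f [x H] := fun _ _ => rfl
  have h1 := smithPair_norm_diff (X := X) (F := F) (hyp.pow g) hp
  have h2 := smithPair_diff_norm (X := X) (k := k) (F := F) (hyp.pow g)
  obtain ⟨s, hs, hle⟩ := (genMod_relCyc (n := 1) hyp (h.cohRank_smithSub hyp hg h1 h2) (h.1 1)).map ev
  have hB : ((inv X k F).map cobd ⊔ (van X k F g ⊔ locZero k (Set.univ : Set X) 1)).map ev ≤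
      Submodule.span k {fun _ => 1} := by
    rw [Submodule.map_sup, Submodule.map_sup]
    refine sup_le ?_ (sup_le ?_ ?_)
    · rintro _ ⟨_, ⟨f, -, rfl⟩, rfl⟩
      refine Submodule.mem_span_singleton.2 ⟨f [], ?_⟩
      funext H
      simp [hev, cobd_cons]
    · rintro _ ⟨f, hf, rfl⟩
      rw [show ev f = 0 from funext fun H => hf _ (hfix H)]
      exact Submodule.zero_mem _
    · rintro _ ⟨f, hf, rfl⟩
      rw [show ev f = 0 from funext fun H => ?_]
      · exact Submodule.zero_mem _
      · obtain ⟨N, hN, h⟩ := hf.2 (x H) trivial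
        exact h _ rfl (by simpa using mem_of_mem_nhds hN)
  have htop : ⊤ ≤ (relCyc k F g 1).map ev := by
    rw [← (Pi.basisFun k S).span_eq, Submodule.span_le]
    rintro _ ⟨H, rfl⟩
    refine ⟨fixInd k H.1, fixInd_mem_relCyc hyp hg H.1, ?_⟩
    funext H'
    rw [hev, Pi.basisFun_apply, Pi.single_apply, fixInd_singleton]
    refine if_congr ?_ rfl rfl
    rw [← hx]
    refine ⟨fun hle => Subtype.ext (le_antisymm ?_ hle), fun e => by rw [e]⟩
    have e := hyp.stabilizer_eq (ne_one_of_mul hg (ha H)) (x := x H') (by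
      have := hle (hax H)
      rwa [hx] at this)
    rw [hx, e]
    exact Subgroup.zpowers_le.2 (hax H)
  have hspan : Submodule.span k (↑(insert (fun _ => 1) s) : Set (S → k)) = ⊤ := by
    rw [eq_top_iff, Finset.coe_insert, Submodule.span_insert]
    exact htop.trans (hle.trans (sup_le_sup_right hB _))
  have hcard := finrank_span_finset_le_card (R := k) (insert (fun _ => 1) s : Finset (S → k))
  rw [Set.finrank, hspan, finrank_top, Module.finrank_fintype_fun_eq_card] at hcard
  have hins := Finset.card_insert_le (fun _ => (1 : k)) s
  rw [← Nat.card_coe_set_eq, Nat.card_eq_fintype_card]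
  have : (D + 1) * B + B = (D + 2) * B := by ring
  omega

/-- Bound for the number of stabilizers contained in a subgroup with `r` generators. -/
def stabBound (B D : ℕ) : ℕ → ℕ
  | 0 => 1
  | r + 1 => stabBound B D r + ((D + 2) * ((2 * D + 3) ^ r * B) + 1)

theorem ncard_stabilizer_le_closure (hyp : SmithHyp E X p) (hp : (p : k) = 0)
    (h : BettiBound X k (⊥ : Subgroup E) B D) (s : Finset E) :
    BettiBound X k (Subgroup.closure (s : Set E)) ((2 * D + 3) ^ s.card * B) D ∧
      {H : Subgroup E | (∃ x : X, H = MulAction.stabilizer E x) ∧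
        H ≤ Subgroup.closure (s : Set E)}.ncard ≤ stabBound B D s.card := by
  classical
  induction s using Finset.induction_on with
  | empty =>
    rw [Finset.coe_empty, Subgroup.closure_empty]
    refine ⟨by simpa using h, ?_⟩
    refine (Set.ncard_le_ncard (t := {⊥}) (fun H hH => le_bot_iff.1 hH.2)).trans ?_
    simp [stabBound]
  | insert g s hgs ih =>
    have e : Subgroup.closure ((insert g s : Finset E) : Set E) =
        Subgroup.closure (s : Set E) ⊔ Subgroup.zpowers g := by
      rw [Finset.coe_insert, Set.insert_eq, Subgroup.closure_union,
        ← Subgroup.zpowers_eq_closure, sup_comm]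
    rw [e, Finset.card_insert_of_notMem hgs]
    obtain ⟨ih1, ih2⟩ := ih
    by_cases hg : g ∈ Subgroup.closure (s : Set E)
    · rw [sup_eq_left.2 (Subgroup.zpowers_le.2 hg)]
      refine ⟨ih1.mono (Nat.mul_le_mul_right _ (Nat.pow_le_pow_right (by omega) (by omega))),
        ih2.trans ?_⟩
      rw [stabBound]
      omega
    · refine ⟨?_, ?_⟩
      · rw [pow_succ', mul_assoc]
        exact ih1.sup_zpowers hyp hp hg
      · rw [stabBound]
        refine (Set.ncard_le_ncard (t := _ ∪ _) ?_).trans ((Set.ncard_union_le _ _).trans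
          (add_le_add ih2 (ncard_stabilizer_le ih1 hyp hp hg)))
        rintro H ⟨⟨x, hx⟩, hle⟩
        by_cases hH : H ≤ Subgroup.closure (s : Set E)
        · exact Or.inl ⟨⟨x, hx⟩, hH⟩
        · obtain ⟨c, hcH, hc⟩ := SetLike.not_le_iff_exists.1 hH
          obtain ⟨a, ha, j, hj, rfl⟩ := hyp.exists_eq_mul_pow (hle hcH)
          have hj0 : j ≠ 0 := by
            rintro rfl
            exact hc (by simpa using ha)
          have hfix : [x] ∈ fixL (Subgroup.closure (s : Set E)) g := by
            refine mem_fixL_of_zpow hyp (m := (j : ℤ)) (fun hd => ?_) ha fun y hy => ?_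
            · exact hj0 (Nat.eq_zero_of_dvd_of_lt (Int.natCast_dvd_natCast.1 hd) hj)
            · rw [List.mem_singleton.1 hy, zpow_natCast, mul_comm]
              rw [hx] at hcH
              exact hcH
          obtain ⟨b, hb, hbx⟩ := hfix
          exact Or.inr ⟨x, hx, b, hb, by rw [hx]; exact hbx x (by simp)⟩

end Count

theorem exists_invariant_metric {E X : Type*} [Group E] [Finite E] [MulAction E X]
    [t : TopologicalSpace X] [TopologicalSpace.MetrizableSpace X]
    (hc : ∀ a : E, Continuous fun x : X => a • x) :
    ∃ m : MetricSpace X, m.toUniformSpace.toTopologicalSpace = t ∧ IsIsometricSMul E X := by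
  have : Fintype E := Fintype.ofFinite E
  let := TopologicalSpace.metrizableSpaceMetric X
  let ι : X → E → X := fun x a => a • x
  have hι : Topology.IsEmbedding ι :=
    .of_leftInverse (f := fun f : E → X => f 1) (fun x => one_smul E x) (continuous_apply 1)
      (continuous_pi hc)
  have hle : ∀ (a : E) (x y : X), dist (ι (a • x)) (ι (a • y)) ≤ dist (ι x) (ι y) := by
    intro a x y
    refine (dist_pi_le_iff dist_nonneg).2 fun b => ?_
    simp only [ι, smul_smul]
    exact dist_le_pi_dist (ι x) (ι y) (b * a)
  refine ⟨hι.comapMetricSpace ι, rfl, ?_⟩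
  let := hι.comapMetricSpace ι
  refine ⟨fun a => Isometry.of_dist_eq fun x y => le_antisymm (hle a x y) ?_⟩
  have := hle a⁻¹ (a • x) (a • y)
  rwa [inv_smul_smul, inv_smul_smul] at this

end AlexanderSpanier

open AlexanderSpanier in
/-- For a compact topological `n`-manifold `M` and a natural number `r`, there is a
constant `C` such that for every prime `p` and every elementary abelian `p`-group `E`
of rank `r` acting continuously and effectively on `M` whose point stabilizers are all
trivial or of order `p`, the set of stabilizer subgroups is finite of size at most `C`. -/
theorem stabilizer_bound_of_rank_one_stabilizers
    (n r : ℕ) (M : Type*) [TopologicalSpace M] [T2Space M]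
    [SecondCountableTopology M] [ChartedSpace (EuclideanSpace ℝ (Fin n)) M]
    [CompactSpace M] :
    ∃ C : ℕ, ∀ (p : ℕ), p.Prime →
      ∀ (E : Type) [CommGroup E] [Finite E] [MulAction E M],
        (∀ g : E, g ^ p = 1) →
        Group.rank E = r →
        (∀ g : E, Continuous fun x : M => g • x) →
        (∀ g : E, (∀ x : M, g • x = x) → g = 1) →
        (∀ x : M, MulAction.stabilizer E x = ⊥ ∨ Nat.card (MulAction.stabilizer E x) = p) →
        (Set.range fun x : M => MulAction.stabilizer E x).Finite ∧
        (Set.range fun x : M => MulAction.stabilizer E x).ncard ≤ C := by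
  have hmet : TopologicalSpace.MetrizableSpace M := inferInstance
  obtain ⟨B, D, hBD⟩ := finiteImage_univ (X := M) (E := EuclideanSpace ℝ (Fin n))
  refine ⟨stabBound B D r, fun p hprime E _ _ _ hpow hrank hcont _ hstab => ⟨Set.toFinite _, ?_⟩⟩
  have : Fact p.Prime := ⟨hprime⟩
  have hbetti := hBD (ZMod p)
  have hyp : SmithHyp E M p := by
    refine ⟨hprime, hpow, fun a b x ha hax hbx => ?_⟩
    have haS : a ∈ MulAction.stabilizer E x := hax
    rcases hstab x with h | h
    · rw [h] at haS
      exact absurd haS ha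
    · have hle : Subgroup.zpowers a ≤ MulAction.stabilizer E x := Subgroup.zpowers_le.2 haS
      have hcard : Nat.card (MulAction.stabilizer E x) ≤ Nat.card (Subgroup.zpowers a) := by
        rw [h, Nat.card_zpowers, orderOf_eq_prime (hpow a) ha]
      rw [Subgroup.eq_of_le_of_card_ge hle hcard]
      exact hbx
  obtain ⟨s, hs, htop⟩ := Group.rank_spec E
  obtain ⟨m, hm, hiso⟩ := exists_invariant_metric (E := E) (X := M) hcont
  subst hm
  have key := (ncard_stabilizer_le_closure hyp (CharP.cast_eq_zero (ZMod p) p)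
    (bettiBound_bot hbetti) s).2
  rw [hs, hrank, htop] at key
  refine (Set.ncard_le_ncard ?_).trans key
  rintro _ ⟨x, rfl⟩
  exact ⟨⟨x, rfl⟩, le_top⟩
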